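/- arXiv:2004.11748 — 13 statements merged into one kernel-verified Lean document; each statement's English description precedes it below -/
import Mathlib

section
/- Let ρ be a K-algebra automorphism of K[X,Y] that commutes with D = f(X)∂_Y (i.e., ρ∘D = D∘ρ). Then there exist a, b, c ∈ K with b·c ≠ 0 and p(X) ∈ K[X] such that ρ(X) = a + bX and ρ(Y) = p(X) + cY. -/
open MvPolynomial in
/-- In characteristic zero, a polynomial in two variables whose partial derivative with respect
to the second variable vanishes is a polynomial in the first variable. -/
theorem exists_aeval_eq_of_pderiv_eq_zero {K : Type*} [Field K] [CharZero K]
    {q : MvPolynomial (Fin 2) K} (hq : pderiv 1 q = 0) :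
    ∃ p : Polynomial K, q = Polynomial.aeval (X 0) p := by
  refine ⟨∑ m ∈ q.support, Polynomial.monomial (m 0) (coeff m q), ?_⟩
  rw [map_sum]
  conv_lhs => rw [q.as_sum]
  refine Finset.sum_congr rfl fun m hm ↦ ?_
  have hm1 : m 1 = 0 := by
    by_contra h
    have hle : Finsupp.single 1 1 ≤ m := by
      rw [Finsupp.single_le_iff]
      omega
    have hc : coeff (m - Finsupp.single 1 1) (pderiv 1 q) = 0 := by rw [hq, coeff_zero]
    rw [coeff_pderiv, tsub_add_cancel_of_le hle] at hc
    rcases mul_eq_zero.mp hc with hc | hc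
    · exact mem_support_iff.mp hm hc
    · exact Nat.cast_add_one_ne_zero _ hc
  rw [Polynomial.aeval_monomial, monomial_eq, Finsupp.prod_fintype _ _ (by simp)]
  simp [Fin.prod_univ_two, hm1, algebraMap_eq]

open MvPolynomial in
theorem aeval_X_zero_injective {K : Type*} [Field K] :
    Function.Injective
      (Polynomial.aeval (X 0 : MvPolynomial (Fin 2) K) : Polynomial K →ₐ[K] _) := by
  refine Function.LeftInverse.injective (g := aeval fun _ ↦ (Polynomial.X : Polynomial K)) ?_
  intro p
  rw [← Polynomial.aeval_algHom_apply, aeval_X, Polynomial.aeval_X_left_apply]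


/-- Let `K` be an algebraically closed field of characteristic zero and
let `D = f(X)∂_Y` be the `K`-derivation of `K[X,Y]` with `D(X) = 0`, `D(Y) = f(X)`
(`f ≠ 0`).  If a `K`-algebra automorphism `ρ` of `K[X,Y]` commutes with `D`, then there
are `a, b, c ∈ K` with `b·c ≠ 0` and `p ∈ K[X]` such that `ρ(X) = a + bX` and
`ρ(Y) = p(X) + cY`. -/
theorem isotropy_of_fX_dY {K : Type*} [Field K] [IsAlgClosed K] [CharZero K]
    (f : Polynomial K) (hf : f ≠ 0)
    (D : Derivation K (MvPolynomial (Fin 2) K) (MvPolynomial (Fin 2) K))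
    (hDX : D (MvPolynomial.X 0) = 0)
    (hDY : D (MvPolynomial.X 1) = Polynomial.aeval (MvPolynomial.X 0) f)
    (ρ : MvPolynomial (Fin 2) K ≃ₐ[K] MvPolynomial (Fin 2) K)
    (hρ : ∀ q, ρ (D q) = D (ρ q)) :
    ∃ (a b c : K) (p : Polynomial K), b * c ≠ 0 ∧
      ρ (MvPolynomial.X 0) = MvPolynomial.C a + MvPolynomial.C b * MvPolynomial.X 0 ∧
      ρ (MvPolynomial.X 1) =
        Polynomial.aeval (MvPolynomial.X 0) p + MvPolynomial.C c * MvPolynomial.X 1 := by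
  set ι : Polynomial K →ₐ[K] MvPolynomial (Fin 2) K := Polynomial.aeval (MvPolynomial.X 0) with hι
  have hι_inj : Function.Injective ι := aeval_X_zero_injective
  have hfι : ι f ≠ 0 := (map_ne_zero_iff ι hι_inj).mpr hf
  have hD : D = ι f • MvPolynomial.pderiv 1 := by
    refine MvPolynomial.derivation_ext fun i ↦ ?_
    fin_cases i
    · simp [hDX, MvPolynomial.pderiv_X]
    · simp [hDY, MvPolynomial.pderiv_X]
  have hDq (q) : D q = ι f * MvPolynomial.pderiv 1 q := by rw [hD]; rfl
  have hker (q) (hq : D q = 0) : ∃ p, q = ι p := by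
    rw [hDq] at hq
    exact exists_aeval_eq_of_pderiv_eq_zero ((mul_eq_zero.mp hq).resolve_left hfι)
  have hDι (p) : D (ι p) = 0 := by
    rw [hι, Derivation.map_aeval, hDX, smul_zero]
  obtain ⟨g, hg⟩ := hker (ρ (MvPolynomial.X 0)) (by rw [← hρ, hDX, map_zero])
  obtain ⟨h, hh⟩ := hker (ρ.symm (MvPolynomial.X 0)) (ρ.injective (by
    rw [hρ, ρ.apply_symm_apply, hDX, map_zero]))
  have hρι (p) : ρ (ι p) = ι (p.comp g) := by
    rw [hι, ← Polynomial.aeval_algHom_apply, Polynomial.aeval_comp, ← hι, ← hg]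
  have hcomp : h.comp g = Polynomial.X := hι_inj (by
    rw [← hρι, ← hh, ρ.apply_symm_apply, hι, Polynomial.aeval_X])
  have hdeg : g.natDegree = 1 := by
    have := congrArg Polynomial.natDegree hcomp
    rw [Polynomial.natDegree_comp, Polynomial.natDegree_X] at this
    exact (mul_eq_one.mp this).2
  have hfg : ι f * MvPolynomial.pderiv 1 (ρ (MvPolynomial.X 1)) = ι (f.comp g) := by
    rw [← hDq, ← hρ, hDY, hρι]
  obtain ⟨s, hs⟩ := hker (MvPolynomial.pderiv 1 (ρ (MvPolynomial.X 1))) (by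
    have := hDι (f.comp g)
    rw [← hfg, Derivation.leibniz, hDι, smul_zero, add_zero, smul_eq_mul] at this
    exact (mul_eq_zero.mp this).resolve_left hfι)
  have hfs : f * s = f.comp g := hι_inj (by rw [← hfg, map_mul, hs])
  have hfg0 : f.comp g ≠ 0 := fun h0 ↦ hf <| hι_inj <| ρ.injective (by
    rw [hρι, h0, map_zero, map_zero])
  have hs0 : s ≠ 0 := right_ne_zero_of_mul (hfs ▸ hfg0)
  have hsdeg : s.natDegree = 0 := by
    have := congrArg Polynomial.natDegree hfs
    rw [Polynomial.natDegree_mul hf hs0, Polynomial.natDegree_comp, hdeg] at this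
    omega
  obtain ⟨c, rfl⟩ := Polynomial.natDegree_eq_zero.mp hsdeg
  have hιC (k : K) : ι (Polynomial.C k) = MvPolynomial.C k := Polynomial.aeval_C _ k
  obtain ⟨p, hp⟩ := hker (ρ (MvPolynomial.X 1) - MvPolynomial.C c * MvPolynomial.X 1) (by
    rw [hDq, map_sub, hs, hιC, MvPolynomial.pderiv_C_mul, MvPolynomial.pderiv_X_self,
      mul_one, sub_self, mul_zero])
  refine ⟨g.coeff 0, g.coeff 1, c, p, mul_ne_zero ?_ ?_, ?_, sub_eq_iff_eq_add.mp hp⟩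
  · rw [← hdeg, Polynomial.coeff_natDegree]
    exact Polynomial.leadingCoeff_ne_zero.mpr (by rintro rfl; simp at hdeg)
  · rintro rfl
    exact hs0 Polynomial.C_0
  · rw [hg]
    conv_lhs => rw [Polynomial.eq_X_add_C_of_natDegree_le_one hdeg.le]
    rw [map_add, map_mul, hιC, hιC, hι, Polynomial.aeval_X, add_comm]
end

section
/- Let d be the K-derivation of K[X,Y] with d(X) = X and d(Y) = Yˢ + pX, where p ∈ K* and s ≥ 2. A K-algebra automorphism ρ of K[X,Y] commutes with d (ρ∘d = d∘ρ) if and only if there exists c ∈ K with c^{s-1} = 1 such that ρ(X) = cX and ρ(Y) = cY. -/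
open Polynomial in
/-- The derivation `∂/∂X` of `K[X][Y]`, acting on coefficients. -/
noncomputable def derivativeCoeffs {K : Type*} [Field K] : K[X][X] →ₗ[K] K[X][X] :=
  (PolynomialModule.equivPolynomialSelf (R := K[X])).toLinearMap.restrictScalars K ∘ₗ
    (derivative' : Derivation K K[X] K[X]).mapCoeffs.toLinearMap

open Polynomial in
/-- The derivation `X ∂/∂X + (Yˢ + pX) ∂/∂Y` of `K[X][Y]`, as a plain map. -/
noncomputable def shamsuddinLike {K : Type*} [Field K] (p : K) (s : ℕ) (F : K[X][X]) : K[X][X] :=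
  C X * derivativeCoeffs F + derivative F * (X ^ s + C (C p * X))

namespace shamsuddinLike

open Polynomial

variable {K : Type*} [Field K] {p : K} {s : ℕ}

lemma coeff_derivativeCoeffs (F : K[X][X]) (i : ℕ) :
    (derivativeCoeffs F).coeff i = derivative (F.coeff i) := rfl

lemma derivativeCoeffs_mul (F G : K[X][X]) :
    derivativeCoeffs (F * G) = F * derivativeCoeffs G + G * derivativeCoeffs F := by
  change PolynomialModule.equivPolynomialSelf (derivative'.mapCoeffs (F * G)) =
    F * PolynomialModule.equivPolynomialSelf (derivative'.mapCoeffs G) +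
      G * PolynomialModule.equivPolynomialSelf (derivative'.mapCoeffs F)
  rw [Derivation.leibniz, map_add, map_smul, map_smul, smul_eq_mul, smul_eq_mul]

lemma derivativeCoeffs_C (a : K[X]) : derivativeCoeffs (C a) = C (derivative a) := by
  ext i : 1
  rw [coeff_derivativeCoeffs, coeff_C, coeff_C]
  split_ifs <;> simp

lemma derivativeCoeffs_X : derivativeCoeffs (X : K[X][X]) = 0 := by
  ext i : 1
  rw [coeff_derivativeCoeffs, coeff_X]
  split_ifs <;> simp

lemma apply_C (a : K[X]) : shamsuddinLike p s (C a) = C (X * derivative a) := by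
  simp [shamsuddinLike, derivativeCoeffs_C]

lemma apply_X : shamsuddinLike p s X = X ^ s + C (C p * X) := by
  simp [shamsuddinLike, derivativeCoeffs_X]

lemma apply_add (F G : K[X][X]) :
    shamsuddinLike p s (F + G) = shamsuddinLike p s F + shamsuddinLike p s G := by
  simp only [shamsuddinLike, map_add]
  ring

lemma apply_mul (F G : K[X][X]) :
    shamsuddinLike p s (F * G) = F * shamsuddinLike p s G + G * shamsuddinLike p s F := by
  simp only [shamsuddinLike, derivativeCoeffs_mul, derivative_mul]
  ring

lemma natDegree_apply [CharZero K] (hs : 2 ≤ s) {F : K[X][X]} (hF : F.natDegree ≠ 0) :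
    (shamsuddinLike p s F).natDegree = F.natDegree - 1 + s := by
  have hq : ((X : K[X][X]) ^ s + C (C p * X)).natDegree = s := natDegree_X_pow_add_C
  have hF' : derivative F ≠ 0 := fun h => hF (derivative_eq_zero.1 h)
  have hq0 : (X : K[X][X]) ^ s + C (C p * X) ≠ 0 := by
    intro h
    rw [h, natDegree_zero] at hq
    omega
  have h2 : (derivative F * ((X : K[X][X]) ^ s + C (C p * X))).natDegree = F.natDegree - 1 + s := by
    rw [natDegree_mul hF' hq0, hq, natDegree_derivative]
  have h1 : (C X * derivativeCoeffs F).natDegree ≤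
      F.natDegree := by
    refine (natDegree_C_mul_le _ _).trans (natDegree_le_iff_coeff_eq_zero.2 fun i hi => ?_)
    rw [coeff_derivativeCoeffs, coeff_eq_zero_of_natDegree_lt hi, derivative_zero]
  rw [shamsuddinLike, natDegree_add_eq_right_of_natDegree_lt, h2]
  rw [h2]
  omega

lemma eq_C_mul_X_of_X_mul_derivative_eq [CharZero K] {a : K[X]} (h : X * derivative a = a) :
    ∃ c : K, a = C c * X := by
  refine ⟨a.coeff 1, ?_⟩
  ext i
  rw [coeff_C_mul, coeff_X]
  have hi := congrArg (coeff · i) h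
  rcases i with _ | i
  · simpa using hi.symm
  · rcases i with _ | i
    · simp
    · simp only [coeff_X_mul, coeff_derivative] at hi
      have h0 : a.coeff (i + 2) * ((i + 1 : ℕ) : K) = 0 := by
        push_cast at hi ⊢
        linear_combination hi
      simpa [Nat.cast_add_one_ne_zero] using h0

/-- Fixed points of the derivation are the scalar multiples of `X`. -/
lemma eq_of_apply_eq_self [CharZero K] (hs : 2 ≤ s) {F : K[X][X]}
    (h : shamsuddinLike p s F = F) : ∃ c : K, F = C (C c * X) := by
  have h0 : F.natDegree = 0 := by
    by_contra hF
    have := natDegree_apply (p := p) hs hF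
    rw [h] at this
    omega
  obtain ⟨a, rfl⟩ := natDegree_eq_zero.1 h0
  rw [apply_C] at h
  obtain ⟨c, hc⟩ := eq_C_mul_X_of_X_mul_derivative_eq (C_injective h)
  exact ⟨c, by rw [hc]⟩

lemma X_mul_derivative_ne [CharZero K] (hs : 2 ≤ s) {e : K} (he : e ≠ 0) (a : K[X]) :
    X * derivative a ≠ a ^ s + C e * X := by
  intro h
  rcases Nat.eq_zero_or_pos a.natDegree with h0 | h0
  · obtain ⟨b, rfl⟩ := natDegree_eq_zero.1 h0
    have h1 := congrArg (coeff · 1) h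
    rw [← C_pow] at h1
    simp [-map_pow, coeff_C] at h1
    exact he h1.symm
  · have hlt : a.natDegree < s * a.natDegree := by nlinarith
    have h1 : (X * derivative a).natDegree ≤ a.natDegree := by
      refine natDegree_mul_le.trans ?_
      rw [natDegree_X, natDegree_derivative]
      omega
    have h2 : (a ^ s + C e * X).natDegree = s * a.natDegree := by
      rw [natDegree_add_eq_left_of_natDegree_lt, natDegree_pow]
      rw [natDegree_pow, natDegree_C_mul_X e he]
      omega
    rw [h, h2] at h1
    omega

lemma eq_of_apply_eq_pow_add [CharZero K] (hp : p ≠ 0) (hs : 2 ≤ s) {c : K} (hc : c ≠ 0)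
    {G : K[X][X]} (h : shamsuddinLike p s G = G ^ s + C (C p * (C c * X))) :
    c ^ (s - 1) = 1 ∧ G = C (C c) * X := by
  have hn0 : G.natDegree ≠ 0 := by
    intro h0
    obtain ⟨a, rfl⟩ := natDegree_eq_zero.1 h0
    rw [apply_C, ← C_pow, ← C_add] at h
    refine X_mul_derivative_ne hs (mul_ne_zero hp hc) a ?_
    rw [C_injective h, C_mul, mul_assoc]
  have hn1 : G.natDegree = 1 := by
    have h1 := natDegree_apply (p := p) hs hn0
    rw [h, natDegree_add_C, natDegree_pow] at h1
    obtain ⟨n, hn⟩ := Nat.exists_eq_succ_of_ne_zero hn0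
    obtain ⟨t, rfl⟩ := Nat.exists_eq_add_of_le hs
    rw [hn] at h1 ⊢
    simp only [Nat.succ_eq_add_one, Nat.add_sub_cancel] at h1 ⊢
    nlinarith
  obtain ⟨a, ha, b, rfl⟩ := natDegree_eq_one.1 hn1
  rw [apply_add, apply_mul, apply_C, apply_C, apply_X] at h
  have hlead : a = a ^ s := by
    have h1 := congrArg (coeff · s) h
    have h2 : ((C a * X + C b) ^ s).coeff s = a ^ s := by
      have := coeff_pow_of_natDegree_le (m := s) (natDegree_linear_le (a := a) (b := b))
      simpa using this
    obtain ⟨t, rfl⟩ := Nat.exists_eq_add_of_le' hs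
    simpa [h2, coeff_C, coeff_X_mul, mul_comm (X : K[X][X])] using h1
  have ha1 : a ^ (s - 1) = 1 := by
    refine mul_left_cancel₀ ha ?_
    rw [mul_pow_sub_one (by omega), ← hlead, mul_one]
  obtain ⟨α, -, rfl⟩ := Polynomial.isUnit_iff.1
    (IsUnit.of_pow_eq_one ha1 (by omega) : IsUnit a)
  have hb : b = 0 := by
    have h1 := congrArg (fun F => (derivative F).eval 0) h
    have h2 : (0 : K[X]) ^ (s - 1) = 0 := zero_pow (by omega)
    simp [derivative_pow, h2] at h1
    rcases h1 with h1 | h1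
    · rcases h1 with h1 | h1
      · omega
      · exact h1.1
    · simp [h1] at ha
  subst hb
  have h0 := congrArg (eval 0) h
  have hαc : α = c := by
    have h3 := congrArg (coeff · 1) h0
    simp [show s ≠ 0 by omega] at h3
    exact mul_left_cancel₀ hp (by rw [mul_comm, h3])
  subst hαc
  refine ⟨C_injective (by simpa using ha1), by simp⟩

end shamsuddinLike

/-- Let `d` be the `K`-derivation of `K[X,Y]` with `d(X) = X` and
`d(Y) = Yˢ + pX` where `p ∈ K*` and `s ≥ 2`.  A `K`-algebra automorphism `ρ` of
`K[X,Y]` commutes with `d` if and only if there exists `c ∈ K` with `c^(s-1) = 1` such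
that `ρ(X) = cX` and `ρ(Y) = cY`. -/
theorem isotropy_of_shamsuddin_like {K : Type*} [Field K] [IsAlgClosed K] [CharZero K]
    (p : K) (hp : p ≠ 0) (s : ℕ) (hs : 2 ≤ s)
    (d : Derivation K (MvPolynomial (Fin 2) K) (MvPolynomial (Fin 2) K))
    (hdX : d (MvPolynomial.X 0) = MvPolynomial.X 0)
    (hdY : d (MvPolynomial.X 1) =
      MvPolynomial.X 1 ^ s + MvPolynomial.C p * MvPolynomial.X 0)
    (ρ : MvPolynomial (Fin 2) K ≃ₐ[K] MvPolynomial (Fin 2) K) :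
    (∀ q, ρ (d q) = d (ρ q)) ↔
      ∃ c : K, c ^ (s - 1) = 1 ∧
        ρ (MvPolynomial.X 0) = MvPolynomial.C c * MvPolynomial.X 0 ∧
        ρ (MvPolynomial.X 1) = MvPolynomial.C c * MvPolynomial.X 1 := by
  have hdC : ∀ a : K, d (MvPolynomial.C a) = 0 := fun a => d.map_algebraMap a
  have hρC : ∀ a : K, ρ (MvPolynomial.C a) = MvPolynomial.C a := fun a => ρ.commutes a
  constructor
  · intro h
    let φ := (Polynomial.Bivariate.equivMvPolynomial K).symm
    have hφC : ∀ a, φ (MvPolynomial.C a) = Polynomial.C (Polynomial.C a) :=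
      Polynomial.Bivariate.equivMvPolynomial_symm_C
    have hφX : φ (MvPolynomial.X 0) = Polynomial.C Polynomial.X :=
      Polynomial.Bivariate.equivMvPolynomial_symm_X_0
    have hφY : φ (MvPolynomial.X 1) = Polynomial.X := Polynomial.Bivariate.equivMvPolynomial_symm_X_1
    have hφd : ∀ q, φ (d q) = shamsuddinLike p s (φ q) := by
      intro q
      induction q using MvPolynomial.induction_on with
      | C a => rw [hdC, hφC, shamsuddinLike.apply_C]; simp
      | add f g hf hg => rw [map_add, map_add, map_add, hf, hg, shamsuddinLike.apply_add]
      | mul_X f i hf =>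
        rw [d.leibniz, map_mul, shamsuddinLike.apply_mul, ← hf, smul_eq_mul, smul_eq_mul,
          map_add, map_mul, map_mul]
        congr 2
        fin_cases i
        · simp [hdX, hφX, shamsuddinLike.apply_C]
        · simp [hdY, hφX, hφY, hφC, shamsuddinLike.apply_X]
    obtain ⟨c, hc⟩ := shamsuddinLike.eq_of_apply_eq_self (p := p) (s := s) hs
      (F := φ (ρ (MvPolynomial.X 0))) (by rw [← hφd, ← h, hdX])
    have hX : ρ (MvPolynomial.X 0) = MvPolynomial.C c * MvPolynomial.X 0 := by
      apply φ.injective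
      simp [hc, hφC, hφX]
    have hc0 : c ≠ 0 := by
      rintro rfl
      rw [MvPolynomial.C_0, zero_mul, map_eq_zero_iff ρ ρ.injective] at hX
      exact MvPolynomial.X_ne_zero 0 hX
    obtain ⟨hcs, hG⟩ := shamsuddinLike.eq_of_apply_eq_pow_add hp hs hc0
      (G := φ (ρ (MvPolynomial.X 1))) (by
        rw [← hφd, ← h, hdY]
        simp [hρC, hφC, hc])
    refine ⟨c, hcs, hX, ?_⟩
    apply φ.injective
    simp [hG, hφC, hφY]
  · rintro ⟨c, hc, hX, hY⟩ q
    have hcs : c ^ s = c := by rw [← mul_pow_sub_one (by omega) c, hc, mul_one]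
    induction q using MvPolynomial.induction_on with
    | C a => simp [hdC, hρC]
    | add f g hf hg => simp only [map_add, hf, hg]
    | mul_X f i hf =>
      have hi : ρ (d (MvPolynomial.X i)) = d (ρ (MvPolynomial.X i)) := by
        fin_cases i
        · simp [hdX, hX, hdC]
        · simp only [Fin.mk_one, hdY, hY, map_add, map_mul, map_pow, hX, hρC, d.leibniz, hdC,
            smul_eq_mul, mul_pow, ← MvPolynomial.C_pow, hcs]
          ring
      simp only [d.leibniz, map_mul, map_add, smul_eq_mul, hf, hi]
end

section
/- Let d be the K-derivation of K[X,Y] with d(X) = X and d(Y) = Yˢ + pX, where p ∈ K* and s ≥ 2. Then the isotropy group Aut(K[X,Y])_d = {ρ ∈ Aut_K(K[X,Y]) : ρ∘d = d∘ρ} is a group isomorphic to ℤ/(s−1)ℤ. -/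
/-- The isotropy subgroup of a `K`-derivation `d` of a commutative `K`-algebra `A`:
the subgroup of `K`-algebra automorphisms of `A` commuting with `d`. -/
def isotropySubgroup {K A : Type*} [CommRing K] [CommRing A] [Algebra K A]
    (d : Derivation K A A) : Subgroup (A ≃ₐ[K] A) where
  carrier := {ρ | ∀ a, ρ (d a) = d (ρ a)}
  one_mem' := fun _ => rfl
  mul_mem' := by
    intro ρ σ hρ hσ a
    show ρ (σ (d a)) = d (ρ (σ a))
    rw [hσ, hρ]
  inv_mem' := by
    intro ρ hρ a
    apply ρ.injective
    show ρ (ρ.symm (d a)) = ρ (d (ρ.symm a))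
    rw [ρ.apply_symm_apply, hρ, ρ.apply_symm_apply]

/-- The defining relation of `isotropySubgroup` need only be checked on the variables. -/
theorem mem_isotropySubgroup_of_X {σ K : Type*} [CommRing K]
    {d : Derivation K (MvPolynomial σ K) (MvPolynomial σ K)}
    {ρ : MvPolynomial σ K ≃ₐ[K] MvPolynomial σ K}
    (h : ∀ i, ρ (d (MvPolynomial.X i)) = d (ρ (MvPolynomial.X i))) :
    ρ ∈ isotropySubgroup d := by
  intro a
  induction a using MvPolynomial.induction_on with
  | C r =>
    have hC : (MvPolynomial.C r : MvPolynomial σ K) = algebraMap K _ r := rfl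
    rw [hC, ρ.commutes, d.map_algebraMap, map_zero]
  | add f g hf hg => simp only [map_add, hf, hg]
  | mul_X f i hf => simp only [Derivation.leibniz, map_add, map_mul, smul_eq_mul, hf, h]

/-- The action of `Kˣ` on a polynomial ring by scaling every variable. -/
noncomputable def scaleVars (σ K : Type*) [CommRing K] :
    Kˣ →* (MvPolynomial σ K ≃ₐ[K] MvPolynomial σ K) where
  toFun u := AlgEquiv.ofAlgHom
    (MvPolynomial.aeval fun i => MvPolynomial.C (u : K) * MvPolynomial.X i)
    (MvPolynomial.aeval fun i => MvPolynomial.C ((u⁻¹ : Kˣ) : K) * MvPolynomial.X i)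
    (by ext1 i; simp [MvPolynomial.algHom_C, ← mul_assoc, ← MvPolynomial.C_mul])
    (by ext1 i; simp [MvPolynomial.algHom_C, ← mul_assoc, ← MvPolynomial.C_mul])
  map_one' := by
    apply AlgEquiv.coe_toAlgHom_injective
    ext1 i
    simp
  map_mul' u v := by
    apply AlgEquiv.coe_toAlgHom_injective
    ext1 i
    simp [MvPolynomial.algHom_C]
    ring

theorem scaleVars_X {σ K : Type*} [CommRing K] (u : Kˣ) (i : σ) :
    scaleVars σ K u (MvPolynomial.X i) = MvPolynomial.C (u : K) * MvPolynomial.X i := by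
  simp [scaleVars]

theorem scaleVars_injective {σ K : Type*} [CommRing K] [Nonempty σ] :
    Function.Injective (scaleVars σ K) := by
  intro u v h
  obtain ⟨i⟩ := ‹Nonempty σ›
  have h' := congrArg (MvPolynomial.coeff (Finsupp.single i 1))
    (DFunLike.congr_fun h (MvPolynomial.X i))
  simpa [scaleVars_X, MvPolynomial.coeff_C_mul, Units.val_inj] using h'

open Polynomial in
/-- `K[X₀, X₁]` as the ring of polynomials in `X₁` with coefficients in `K[X₀]`. -/
noncomputable def finTwoEquivBivariate (K : Type*) [CommRing K] :
    MvPolynomial (Fin 2) K ≃ₐ[K] K[X][X] :=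
  AlgEquiv.ofAlgHom (MvPolynomial.aeval ![C X, X])
    (Polynomial.eval₂AlgHom (Polynomial.aeval (MvPolynomial.X 0)) (MvPolynomial.X 1)
      fun _ => Commute.all _ _)
    (by ext <;> simp)
    (by ext1 i; fin_cases i <;> simp)

section Bivariate

open Polynomial

theorem natDegree_apply_X_one_ne_zero {R : Type*} [CommRing R] [Nontrivial R]
    {φ : MvPolynomial (Fin 2) R →ₐ[R] R[X][X]} (hφ : Function.Surjective φ) {r₀ : R[X]}
    (h₀ : φ (MvPolynomial.X 0) = C r₀) : (φ (MvPolynomial.X 1)).natDegree ≠ 0 := by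
  intro h
  obtain ⟨r₁, h₁⟩ := natDegree_eq_zero.1 h
  have hfac : φ = (CAlgHom : R[X] →ₐ[R] R[X][X]).comp (MvPolynomial.aeval ![r₀, r₁]) := by
    ext1 i
    fin_cases i
    · simpa using h₀
    · simpa using h₁.symm
  obtain ⟨f, hf⟩ := hφ X
  rw [hfac, AlgHom.comp_apply, CAlgHom_apply] at hf
  have hf' := congrArg natDegree hf
  rw [natDegree_C, natDegree_X] at hf'
  exact zero_ne_one hf'

variable {K : Type*} [Field K]
  {D : Derivation K K[X][X] K[X][X]}

theorem derivation_C_eq (hX : D (C X) = C X) (c : K[X]) :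
    D (C c) = C (X * derivative c) := by
  have h1 : ∀ q : K[X], (C q : K[X][X]) = aeval (C X) q := by
    intro q
    have : (CAlgHom : K[X] →ₐ[K] K[X][X]) = aeval (C X) := by ext; simp
    exact DFunLike.congr_fun this q
  rw [h1 c, Derivation.map_aeval, hX, smul_eq_mul, ← h1, C_mul, mul_comm]

theorem coeff_derivation (hX : D (C X) = C X) (f : K[X][X]) (n : ℕ) :
    (D f).coeff n = X * derivative (f.coeff n) + (D X * derivative f).coeff n := by
  induction f using Polynomial.induction_on' with
  | add f g hf hg =>
    simp only [map_add, coeff_add, hf, hg, mul_add]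
    ring
  | monomial m c =>
    rw [← C_mul_X_pow_eq_monomial, Derivation.leibniz, derivation_C_eq hX,
      Derivation.leibniz_pow, smul_eq_mul, smul_eq_mul, coeff_add, add_comm]
    congr 1
    · rw [smul_eq_mul, mul_comm (X ^ m), coeff_C_mul_X_pow, coeff_C_mul_X_pow]
      split_ifs <;> simp
    · congr 1
      simp [derivative_X_pow]
      ring

variable [CharZero K] {s : ℕ} {q : K[X]}

theorem natDegree_derivation (hs : 2 ≤ s) (hX : D (C X) = C X) (hY : D X = X ^ s + C q)
    {f : K[X][X]} (hf : f.natDegree ≠ 0) : (D f).natDegree = f.natDegree + s - 1 := by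
  have hdeg : (derivative f).natDegree = f.natDegree - 1 := natDegree_derivative f
  have hDX : (X ^ s + C q : K[X][X]).natDegree = s := natDegree_X_pow_add_C
  have hne : derivative f ≠ 0 := fun h => hf (derivative_eq_zero.1 h)
  have hne' : (X ^ s + C q : K[X][X]) ≠ 0 := by
    intro h
    rw [h] at hDX
    simp at hDX
    omega
  have hprod : (D X * derivative f).natDegree = f.natDegree + s - 1 := by
    rw [hY, natDegree_mul hne' hne, hdeg, hDX]
    omega
  apply natDegree_eq_of_le_of_coeff_ne_zero
  · rw [natDegree_le_iff_coeff_eq_zero]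
    intro N hN
    rw [coeff_derivation hX, coeff_eq_zero_of_natDegree_lt (p := f) (by omega),
      coeff_eq_zero_of_natDegree_lt (by omega)]
    simp
  · rw [coeff_derivation hX, coeff_eq_zero_of_natDegree_lt (p := f) (by omega), ← hprod,
      derivative_zero, mul_zero, zero_add, coeff_natDegree, leadingCoeff_ne_zero, hY]
    exact mul_ne_zero hne' hne

theorem eq_of_derivation_eq_self (hs : 2 ≤ s) (hX : D (C X) = C X) (hY : D X = X ^ s + C q)
    {a : K[X][X]} (ha : D a = a) : ∃ c : K, a = C (C c * X) := by
  have h0 : a.natDegree = 0 := by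
    by_contra h
    have := natDegree_derivation hs hX hY h
    rw [ha] at this
    omega
  obtain ⟨r, rfl⟩ := natDegree_eq_zero.1 h0
  rw [derivation_C_eq hX, C_inj] at ha
  refine ⟨r.coeff 1, congrArg C ?_⟩
  ext n
  rcases n with _ | n
  · rw [← ha]
    simp
  · have hn := congrArg (fun t => coeff t (n + 1)) ha
    simp only [coeff_X_mul, coeff_derivative] at hn
    rcases n with _ | n
    · simp
    · have hn' : r.coeff (n + 1 + 1) * ((n : K) + 1) = 0 := by
        push_cast at hn
        linear_combination hn
      have := (mul_eq_zero.1 hn').resolve_right (by exact_mod_cast n.succ_ne_zero)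
      simp [this]

theorem eq_of_derivation_eq_pow_add (hs : 2 ≤ s) (hX : D (C X) = C X) {p : K} (hp : p ≠ 0)
    (hY : D X = X ^ s + C (C p * X)) {b : K[X][X]} {c : K} (hb0 : b.natDegree ≠ 0)
    (hb : D b = b ^ s + C (C p * (C c * X))) :
    c ^ (s - 1) = 1 ∧ b = C (C c) * X := by
  have hdeg := natDegree_derivation hs hX hY hb0
  rw [hb, natDegree_add_C, natDegree_pow] at hdeg
  have h1 : b.natDegree = 1 := by
    obtain ⟨t, rfl⟩ : ∃ t, s = t + 2 := ⟨s - 2, by omega⟩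
    have : (t + 1) * b.natDegree = (t + 1) * 1 := by
      have : (t + 2) * b.natDegree = b.natDegree + t + 1 := by omega
      linarith
    exact Nat.eq_of_mul_eq_mul_left (by omega) this
  obtain ⟨u, hu, v, rfl⟩ := natDegree_eq_one.1 h1
  have hs1 : s - 1 + 1 = s := by omega
  have hpow : u ^ (s - 1) = 1 := by
    have h := congrArg (fun t => coeff t s) hb
    have hcs : ((C u * X + C v) ^ s).coeff s = u ^ s := by
      simpa using coeff_pow_of_natDegree_le (p := C u * X + C v) (m := s) (n := 1) h1.le
    simp only [coeff_derivation hX, hY, coeff_add, hcs] at h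
    simp [coeff_X, coeff_C, show s ≠ 0 by omega, show 1 ≠ s by omega, -map_mul] at h
    apply mul_right_cancel₀ hu
    rw [← pow_succ, hs1, one_mul, ← h]
  have hs1' : s - 1 ≠ 0 := by omega
  obtain ⟨w, rfl⟩ : ∃ w, u = C w :=
    ⟨_, eq_C_of_natDegree_eq_zero (natDegree_eq_zero_of_isUnit (IsUnit.of_pow_eq_one hpow hs1'))⟩
  have hw : w ^ (s - 1) = 1 := by
    rw [← C_pow, ← C_1, C_inj] at hpow
    exact hpow
  have hw0 : w ≠ 0 := by rintro rfl; simp at hu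
  simp only [map_add, Derivation.leibniz, derivation_C_eq hX, hY, smul_eq_mul] at hb
  have hv : v = 0 := by
    have h := congrArg (fun t => (derivative t).eval 0) hb
    simp [derivative_pow, hs1'] at h
    grind
  subst hv
  have h := congrArg (fun t => (t.coeff 0).coeff 1) hb
  simp [show 0 ≠ s by omega, mul_pow, mul_coeff_zero] at h
  have : c = w := by grind
  subst this
  exact ⟨hw, by simp⟩

theorem map_scaleVars_rootsOfUnity {p : K} (hp : p ≠ 0) (hs : 2 ≤ s)
    {d : Derivation K (MvPolynomial (Fin 2) K) (MvPolynomial (Fin 2) K)}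
    (hdX : d (MvPolynomial.X 0) = MvPolynomial.X 0)
    (hdY : d (MvPolynomial.X 1) =
      MvPolynomial.X 1 ^ s + MvPolynomial.C p * MvPolynomial.X 0) :
    (rootsOfUnity (s - 1) K).map (scaleVars (Fin 2) K) = isotropySubgroup d := by
  have hs1 : s - 1 ≠ 0 := by omega
  apply le_antisymm
  · rintro _ ⟨u, hu, rfl⟩
    have hu' : (u : K) ^ s = u := by
      rw [← Nat.sub_add_cancel (by omega : 1 ≤ s), pow_succ,
        (mem_rootsOfUnity' _ _).1 hu, one_mul]
    apply mem_isotropySubgroup_of_X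
    intro i
    have hC : ∀ r : K, (MvPolynomial.C r : MvPolynomial (Fin 2) K) = algebraMap K _ r :=
      fun _ => rfl
    fin_cases i
    · simp [scaleVars_X, hdX, Derivation.leibniz, hC]
    · have hCu : (MvPolynomial.C (u : K) : MvPolynomial (Fin 2) K) ^ s = MvPolynomial.C (u : K) := by
        rw [← MvPolynomial.C_pow, hu']
      rw [hC] at hCu
      simp [scaleVars_X, hdY, Derivation.leibniz, hC, mul_pow, hCu]
      ring
  · intro ρ hρ
    let e := finTwoEquivBivariate K
    have he0 : e (MvPolynomial.X 0) = C X := by simp [e, finTwoEquivBivariate]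
    have he1 : e (MvPolynomial.X 1) = X := by simp [e, finTwoEquivBivariate]
    have heC : ∀ r : K, e (MvPolynomial.C r) = C (C r) := fun r => e.commutes r
    have hρC : e (ρ (MvPolynomial.C p)) = C (C p) := (ρ.trans e).commutes p
    let D : Derivation K K[X][X] K[X][X] :=
      Derivation.mk' (e.toLinearMap ∘ₗ d.toLinearMap ∘ₗ e.symm.toLinearMap)
        (by intro f g; simp [Derivation.leibniz])
    have hD : ∀ f, D (e f) = e (d f) := fun f =>
      congrArg (fun g => e (d g)) (e.symm_apply_apply f)
    have hDX : D (C X) = C X := by rw [← he0, hD, hdX]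
    have hDY : D X = X ^ s + C (C p * X) := by
      conv_lhs => rw [← he1]
      rw [hD, hdY]
      simp [he0, he1, heC]
    obtain ⟨c, hc⟩ := eq_of_derivation_eq_self hs hDX hDY (a := e (ρ (MvPolynomial.X 0)))
      (by rw [hD, ← hρ, hdX])
    have hb0 : (e (ρ (MvPolynomial.X 1))).natDegree ≠ 0 :=
      natDegree_apply_X_one_ne_zero (φ := (ρ.trans e).toAlgHom) (ρ.trans e).surjective hc
    obtain ⟨hc1, hb⟩ := eq_of_derivation_eq_pow_add hs hDX hp hDY (c := c) hb0
      (by rw [hD, ← hρ, hdY]; simp [hc, hρC])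
    refine ⟨Units.ofPowEqOne c (s - 1) hc1 hs1, ?_, ?_⟩
    · exact (mem_rootsOfUnity' _ _).2 hc1
    · apply AlgEquiv.coe_toAlgHom_injective
      ext1 i
      apply e.injective
      fin_cases i
      · simp [scaleVars_X, heC, he0, hc]
      · simp [scaleVars_X, heC, he1, hb]

end Bivariate

/-- Let `d` be the `K`-derivation of `K[X,Y]` with `d(X) = X` and
`d(Y) = Yˢ + pX`, where `p ∈ K*` and `s ≥ 2`.  Then the isotropy group
`Aut(K[X,Y])_d` is isomorphic to `ℤ/(s−1)ℤ`. -/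
theorem isotropy_iso_zmod {K : Type*} [Field K] [IsAlgClosed K] [CharZero K]
    (p : K) (hp : p ≠ 0) (s : ℕ) (hs : 2 ≤ s)
    (d : Derivation K (MvPolynomial (Fin 2) K) (MvPolynomial (Fin 2) K))
    (hdX : d (MvPolynomial.X 0) = MvPolynomial.X 0)
    (hdY : d (MvPolynomial.X 1) =
      MvPolynomial.X 1 ^ s + MvPolynomial.C p * MvPolynomial.X 0) :
    Nonempty (isotropySubgroup d ≃* Multiplicative (ZMod (s - 1))) := by
  have hs1 : s - 1 ≠ 0 := by omega
  have : NeZero (s - 1) := ⟨hs1⟩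
  have hmap := map_scaleVars_rootsOfUnity hp hs hdX hdY
  have hcard : Nat.card (rootsOfUnity (s - 1) K) = s - 1 :=
    HasEnoughRootsOfUnity.natCard_rootsOfUnity K (s - 1)
  have e₁ := (rootsOfUnity (s - 1) K).equivMapOfInjective _ (scaleVars_injective (σ := Fin 2))
  have e₂ : rootsOfUnity (s - 1) K ≃* Multiplicative (ZMod (s - 1)) :=
    mulEquivOfCyclicCardEq (by rw [hcard, Nat.card_eq_fintype_card, Fintype.card_multiplicative, ZMod.card])
  exact ⟨(MulEquiv.subgroupCongr hmap).symm.trans (e₁.symm.trans e₂)⟩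
end

section
/- For λ ∈ K*, the hyperbolic rotation H_λ of B commutes with D if and only if g(X) = λ·g(λX) in K[X]; in particular, if H_λ commutes with D then λ is a root of unity. -/
noncomputable section

/-- The ideal `(XY - φ(Z))` of `K[X,Y,Z]`. -/
def danIdeal (K : Type*) [Field K] (φ : Polynomial K) : Ideal (MvPolynomial (Fin 3) K) :=
  Ideal.span {MvPolynomial.X 0 * MvPolynomial.X 1 - Polynomial.aeval (MvPolynomial.X 2) φ}

/-- The Danielewski surface `B = K[X,Y,Z]/(XY - φ(Z))`. -/
def DanSurf (K : Type*) [Field K] (φ : Polynomial K) : Type _ :=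
  MvPolynomial (Fin 3) K ⧸ danIdeal K φ

instance (K : Type*) [Field K] (φ : Polynomial K) : CommRing (DanSurf K φ) :=
  Ideal.Quotient.commRing _

instance (K : Type*) [Field K] (φ : Polynomial K) : Algebra K (DanSurf K φ) :=
  Ideal.Quotient.algebra _

/-- The image `x` of `X` in `B`. -/
def dx (K : Type*) [Field K] (φ : Polynomial K) : DanSurf K φ :=
  Ideal.Quotient.mk (danIdeal K φ) (MvPolynomial.X 0)

/-- The image `y` of `Y` in `B`. -/
def dy (K : Type*) [Field K] (φ : Polynomial K) : DanSurf K φ :=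
  Ideal.Quotient.mk (danIdeal K φ) (MvPolynomial.X 1)

/-- The image `z` of `Z` in `B`. -/
def dz (K : Type*) [Field K] (φ : Polynomial K) : DanSurf K φ :=
  Ideal.Quotient.mk (danIdeal K φ) (MvPolynomial.X 2)

/-- The subalgebra of `B` generated by `x`, `y`, `z` is everything: induction principle. -/
theorem DanSurf.induction_on {K : Type*} [Field K] {φ : Polynomial K} {P : DanSurf K φ → Prop}
    (b : DanSurf K φ) (algebraMap : ∀ r : K, P (algebraMap K (DanSurf K φ) r))
    (x : P (dx K φ)) (y : P (dy K φ)) (z : P (dz K φ))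
    (add : ∀ a b, P a → P b → P (a + b)) (mul : ∀ a b, P a → P b → P (a * b)) : P b := by
  obtain ⟨p, rfl⟩ := Ideal.Quotient.mk_surjective (I := danIdeal K φ) b
  induction p using MvPolynomial.induction_on with
  | C r => exact algebraMap r
  | add p q hp hq => exact add _ _ hp hq
  | mul_X p i hp =>
    refine mul (Ideal.Quotient.mk (danIdeal K φ) p)
      (Ideal.Quotient.mk (danIdeal K φ) (MvPolynomial.X i)) hp ?_
    fin_cases i
    exacts [x, y, z]

/-- Restriction of functions on the surface to the line `Y = 0`, `Z = r`,
for a root `r` of `φ`. -/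
def DanSurf.restrictLine {K : Type*} [Field K] (φ : Polynomial K) (r : K) (hr : φ.eval r = 0) :
    DanSurf K φ →ₐ[K] Polynomial K :=
  Ideal.Quotient.liftₐ (danIdeal K φ)
    (MvPolynomial.aeval ![Polynomial.X, 0, Polynomial.C r]) (by
      intro a ha
      have hle : danIdeal K φ ≤ RingHom.ker
          (MvPolynomial.aeval (R := K) ![Polynomial.X, 0, Polynomial.C r]) := by
        refine Ideal.span_le.mpr (Set.singleton_subset_iff.mpr ?_)
        have hC : Polynomial.aeval (Polynomial.C r) φ = 0 := by
          rw [← Polynomial.algebraMap_eq, Polynomial.aeval_algebraMap_apply]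
          simp [hr]
        simp [RingHom.mem_ker, ← Polynomial.aeval_algHom_apply, hC]
      exact hle ha)

theorem DanSurf.restrictLine_dx {K : Type*} [Field K] (φ : Polynomial K) (r : K)
    (hr : φ.eval r = 0) : DanSurf.restrictLine φ r hr (dx K φ) = Polynomial.X :=
  (Ideal.Quotient.liftₐ_apply _ _ _ _).trans
    ((Ideal.Quotient.lift_mk _ _ _).trans (by simp))

/-- `x` is transcendental over `K` when `φ` has a root. -/
theorem aeval_dx_injective {K : Type*} [Field K] (φ : Polynomial K) (r : K)
    (hr : φ.eval r = 0) :
    Function.Injective (Polynomial.aeval (R := K) (dx K φ)) := by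
  intro p q h
  simpa [← Polynomial.aeval_algHom_apply, DanSurf.restrictLine_dx] using
    congrArg (DanSurf.restrictLine φ r hr) h

/-- A derivation commutes with an algebra automorphism of `B` as soon as it does so on
`x`, `y`, `z`. -/
theorem DanSurf.commutes_of_generators {K : Type*} [Field K] {φ : Polynomial K}
    (D : Derivation K (DanSurf K φ) (DanSurf K φ)) (H : DanSurf K φ ≃ₐ[K] DanSurf K φ)
    (hx : H (D (dx K φ)) = D (H (dx K φ))) (hy : H (D (dy K φ)) = D (H (dy K φ)))
    (hz : H (D (dz K φ)) = D (H (dz K φ))) (b : DanSurf K φ) : H (D b) = D (H b) := by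
  induction b using DanSurf.induction_on with
  | algebraMap r => simp
  | x => exact hx
  | y => exact hy
  | z => exact hz
  | add a b ha hb => simp [ha, hb]
  | mul a b ha hb => simp [ha, hb]

/-- A nonzero `g` with `g(X) = λ g(λX)` forces `λ ^ (deg g + 1) = 1`. -/
theorem pow_natDegree_succ_eq_one {K : Type*} [Field K] {g : Polynomial K} (hg : g ≠ 0) {c : K}
    (h : g = Polynomial.C c * g.comp (Polynomial.C c * Polynomial.X)) :
    c ^ (g.natDegree + 1) = 1 := by
  have hc := congrArg (fun p => Polynomial.coeff p g.natDegree) h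
  simp only [Polynomial.coeff_C_mul, Polynomial.comp_C_mul_X_coeff] at hc
  have h0 : g.coeff g.natDegree ≠ 0 := by simpa using hg
  apply mul_left_cancel₀ h0
  rw [mul_one, pow_succ]
  linear_combination -hc

/-- For `λ ∈ K*`, the hyperbolic rotation `H_λ` of
`B = K[X,Y,Z]/(XY - φ(Z))` commutes with the locally nilpotent derivation `D`
(`D(x) = 0`, `D(y) = g(x)·φ'(z)`, `D(z) = g(x)·x`, `g ≠ 0`) if and only if
`g(X) = λ·g(λX)` in `K[X]`; in particular, if `H_λ` commutes with `D` then `λ` is a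
root of unity. -/
theorem hyperbolic_rotation_commutes_iff {K : Type*} [Field K] [IsAlgClosed K] [CharZero K]
    (φ : Polynomial K) (hφ : 1 < φ.natDegree) (g : Polynomial K) (hg : g ≠ 0)
    (D : Derivation K (DanSurf K φ) (DanSurf K φ))
    (hDx : D (dx K φ) = 0)
    (hDy : D (dy K φ) =
      Polynomial.aeval (dx K φ) g * Polynomial.aeval (dz K φ) (Polynomial.derivative φ))
    (hDz : D (dz K φ) = Polynomial.aeval (dx K φ) g * dx K φ)
    (lam : K) (hlam : lam ≠ 0)
    (H : DanSurf K φ ≃ₐ[K] DanSurf K φ)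
    (hHx : H (dx K φ) = lam • dx K φ)
    (hHy : H (dy K φ) = lam⁻¹ • dy K φ)
    (hHz : H (dz K φ) = dz K φ) :
    ((∀ b, H (D b) = D (H b)) ↔
      g = Polynomial.C lam * g.comp (Polynomial.C lam * Polynomial.X)) ∧
    ((∀ b, H (D b) = D (H b)) → ∃ m : ℕ, 1 ≤ m ∧ lam ^ m = 1) := by
  have haeval (p : Polynomial K) : H (Polynomial.aeval (dx K φ) p) =
      Polynomial.aeval (dx K φ) (p.comp (Polynomial.C lam * Polynomial.X)) := by
    rw [Polynomial.aeval_comp, ← AlgEquiv.coe_toAlgHom, ← Polynomial.aeval_algHom_apply]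
    simp [hHx, Algebra.smul_def]
  have forward (h : ∀ b, H (D b) = D (H b)) :
      g = Polynomial.C lam * g.comp (Polynomial.C lam * Polynomial.X) := by
    obtain ⟨r, hr⟩ := IsAlgClosed.exists_root φ
      (Polynomial.degree_ne_of_natDegree_ne (n := 0) (by omega))
    have hz := h (dz K φ)
    rw [hHz, hDz, map_mul, haeval, hHx] at hz
    apply mul_right_cancel₀ (Polynomial.X_ne_zero (R := K))
    apply aeval_dx_injective φ r hr
    simp only [map_mul, Polynomial.aeval_X, Polynomial.aeval_C]
    rw [← hz, Algebra.smul_def]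
    ring
  refine ⟨⟨forward, fun h => ?_⟩, fun h => ⟨g.natDegree + 1, by omega,
    pow_natDegree_succ_eq_one hg (forward h)⟩⟩
  have hgx : Polynomial.aeval (dx K φ) g = lam • H (Polynomial.aeval (dx K φ) g) := by
    rw [haeval, Algebra.smul_def]
    conv_lhs => rw [h]
    rw [map_mul, Polynomial.aeval_C]
  refine DanSurf.commutes_of_generators D H ?_ ?_ ?_
  · rw [hHx, D.map_smul, hDx, map_zero, smul_zero]
  · have hφz : H (Polynomial.aeval (dz K φ) (Polynomial.derivative φ)) =
        Polynomial.aeval (dz K φ) (Polynomial.derivative φ) := by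
      rw [← AlgEquiv.coe_toAlgHom, ← Polynomial.aeval_algHom_apply, AlgEquiv.coe_toAlgHom, hHz]
    rw [hHy, D.map_smul, hDy, map_mul, hφz]
    conv_rhs => rw [hgx]
    rw [smul_mul_assoc, smul_smul, inv_mul_cancel₀ hlam, one_smul]
  · rw [hHz, hDz, map_mul, hHx]
    conv_rhs => rw [hgx]
    rw [smul_mul_assoc, mul_smul_comm]
end
end

section
/- No K-algebra automorphism I of B satisfying I(x) = y, I(y) = x and I(z) = z commutes with D; that is, for any such I one has I∘D ≠ D∘I. -/
noncomputable section

/-- A `K`-point `(a, b, c)` with `a * b = φ(c)` gives an evaluation homomorphism on the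
Danielewski surface. -/
theorem exists_algHom_of_mul_eq {K : Type*} [Field K] (φ : Polynomial K) {a b c : K}
    (h : a * b = φ.eval c) :
    ∃ e : DanSurf K φ →ₐ[K] K, e (dx K φ) = a ∧ e (dy K φ) = b ∧ e (dz K φ) = c := by
  have hker : ∀ p ∈ danIdeal K φ, MvPolynomial.aeval ![a, b, c] p = 0 := by
    intro p hp
    have hle : danIdeal K φ ≤ RingHom.ker (MvPolynomial.aeval (R := K) ![a, b, c]) := by
      rw [danIdeal, Ideal.span_singleton_le_iff_mem, RingHom.mem_ker, map_sub, map_mul,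
        ← Polynomial.aeval_algHom_apply]
      simp [h, Polynomial.coe_aeval_eq_eval]
    exact hle hp
  refine ⟨Ideal.Quotient.liftₐ (danIdeal K φ) (MvPolynomial.aeval ![a, b, c]) hker, ?_, ?_, ?_⟩
  · exact MvPolynomial.aeval_X (R := K) ![a, b, c] 0
  · exact MvPolynomial.aeval_X (R := K) ![a, b, c] 1
  · exact MvPolynomial.aeval_X (R := K) ![a, b, c] 2

/-- No `K`-algebra automorphism `I` of `B = K[X,Y,Z]/(XY - φ(Z))`
with `I(x) = y`, `I(y) = x`, `I(z) = z` commutes with the nonzero locally nilpotent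
derivation `D` given by `D(x) = 0`, `D(y) = g(x)·φ'(z)`, `D(z) = g(x)·x`. -/
theorem involution_not_in_isotropy {K : Type*} [Field K] [IsAlgClosed K] [CharZero K]
    (φ : Polynomial K) (hφ : 1 < φ.natDegree) (g : Polynomial K) (hg : g ≠ 0)
    (D : Derivation K (DanSurf K φ) (DanSurf K φ))
    (hDx : D (dx K φ) = 0)
    (hDy : D (dy K φ) =
      Polynomial.aeval (dx K φ) g * Polynomial.aeval (dz K φ) (Polynomial.derivative φ))
    (hDz : D (dz K φ) = Polynomial.aeval (dx K φ) g * dx K φ)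
    (I : DanSurf K φ ≃ₐ[K] DanSurf K φ)
    (hIx : I (dx K φ) = dy K φ) (hIy : I (dy K φ) = dx K φ) (hIz : I (dz K φ) = dz K φ) :
    ¬ (∀ b, I (D b) = D (I b)) := by
  intro hcomm
  have hDy0 : D (dy K φ) = 0 := by rw [← hIx, ← hcomm, hDx, map_zero]
  obtain ⟨a, ha⟩ : ∃ a, (Polynomial.X * g).eval a ≠ 0 := by
    by_contra! h
    exact mul_ne_zero Polynomial.X_ne_zero hg (Polynomial.zero_of_eval_zero _ h)
  obtain ⟨c, hc⟩ : ∃ c, (Polynomial.derivative φ).eval c ≠ 0 := by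
    by_contra! h
    have := Polynomial.derivative_eq_zero.mp (Polynomial.zero_of_eval_zero _ h)
    omega
  rw [Polynomial.eval_mul, Polynomial.eval_X] at ha
  obtain ⟨e, hex, -, hez⟩ :=
    exists_algHom_of_mul_eq φ (mul_div_cancel₀ (φ.eval c) (left_ne_zero_of_mul ha))
  have h := congrArg e (hDy.symm.trans hDy0)
  rw [map_mul, map_zero, ← Polynomial.aeval_algHom_apply, ← Polynomial.aeval_algHom_apply,
    hex, hez, Polynomial.coe_aeval_eq_eval, Polynomial.coe_aeval_eq_eval] at h
  exact mul_ne_zero (right_ne_zero_of_mul ha) hc h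
end
end

section
/- Every triangular automorphism T of B commutes with D, i.e., T∘D = D∘T. -/
noncomputable section

open MvPolynomial in
/-- The image of `X` is not a zero divisor on the Danielewski surface when `φ ≠ 0`. -/
theorem dx_mul_left_cancel {K : Type*} [Field K] [Infinite K] {φ : Polynomial K} (hφ : φ ≠ 0)
    {a b : DanSurf K φ} (hab : dx K φ * a = dx K φ * b) : a = b := by
  obtain ⟨p, rfl⟩ := Ideal.Quotient.mk_surjective (I := danIdeal K φ) a
  obtain ⟨q, rfl⟩ := Ideal.Quotient.mk_surjective (I := danIdeal K φ) b
  have hmem : (X 0 * p - X 0 * q : MvPolynomial (Fin 3) K) ∈ danIdeal K φ := by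
    apply Ideal.Quotient.eq.mp
    rw [map_mul, map_mul]
    exact hab
  apply Ideal.Quotient.eq.mpr
  obtain ⟨r, hr⟩ := Ideal.mem_span_singleton.mp hmem
  have hX : Prime (X 0 : MvPolynomial (Fin 3) K) := X_prime
  have hdvd : (X 0 : MvPolynomial (Fin 3) K) ∣ (X 0 * X 1 - Polynomial.aeval (X 2) φ) * r :=
    ⟨p - q, by rw [← hr]; ring⟩
  rcases hX.dvd_or_dvd hdvd with ⟨s, hs⟩ | ⟨s, rfl⟩
  · refine absurd (Polynomial.funext fun c => ?_) hφ
    have hc := congrArg (aeval (![0, 0, c] : Fin 3 → K)) hs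
    rw [map_sub, ← Polynomial.aeval_algHom_apply] at hc
    simpa [Polynomial.coe_aeval_eq_eval] using hc
  · refine Ideal.mem_span_singleton.mpr ⟨s, mul_left_cancel₀ hX.ne_zero ?_⟩
    linear_combination hr

/-- Every element of the Danielewski surface is a polynomial in `x`, `y`, `z`. -/
theorem DanSurf.induction {K : Type*} [Field K] {φ : Polynomial K} {P : DanSurf K φ → Prop}
    (algebraMap : ∀ c : K, P (algebraMap K (DanSurf K φ) c))
    (add : ∀ a b, P a → P b → P (a + b)) (mul : ∀ a b, P a → P b → P (a * b))
    (x : P (dx K φ)) (y : P (dy K φ)) (z : P (dz K φ)) (b : DanSurf K φ) : P b := by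
  obtain ⟨p, rfl⟩ := Ideal.Quotient.mk_surjective (I := danIdeal K φ) b
  induction p using MvPolynomial.induction_on with
  | C c => exact algebraMap c
  | add p q hp hq => rw [map_add]; exact add _ _ hp hq
  | mul_X p i hp =>
    rw [map_mul]
    refine mul _ _ hp ?_
    fin_cases i
    exacts [x, y, z]

/-- Every triangular automorphism `T` of `B = K[X,Y,Z]/(XY - φ(Z))`
(`T(x) = x`, `T(z) = z + x·h(x)`, `x·T(y) = φ(T(z))` for some `h ∈ K[X]`) commutes
with the locally nilpotent derivation `D` given by `D(x) = 0`, `D(y) = g(x)·φ'(z)`,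
`D(z) = g(x)·x`. -/
theorem triangular_commutes_xy {K : Type*} [Field K] [IsAlgClosed K] [CharZero K]
    (φ : Polynomial K) (hφ : 1 < φ.natDegree) (g : Polynomial K) (hg : g ≠ 0)
    (D : Derivation K (DanSurf K φ) (DanSurf K φ))
    (hDx : D (dx K φ) = 0)
    (hDy : D (dy K φ) =
      Polynomial.aeval (dx K φ) g * Polynomial.aeval (dz K φ) (Polynomial.derivative φ))
    (hDz : D (dz K φ) = Polynomial.aeval (dx K φ) g * dx K φ)
    (T : DanSurf K φ ≃ₐ[K] DanSurf K φ) (h : Polynomial K)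
    (hTx : T (dx K φ) = dx K φ)
    (hTz : T (dz K φ) = dz K φ + dx K φ * Polynomial.aeval (dx K φ) h)
    (hTy : dx K φ * T (dy K φ) = Polynomial.aeval (T (dz K φ)) φ) :
    ∀ b, T (D b) = D (T b) := by
  have hφ₀ : φ ≠ 0 := by rintro rfl; simp at hφ
  have hTaeval : ∀ (p : Polynomial K) (a : DanSurf K φ),
      T (Polynomial.aeval a p) = Polynomial.aeval (T a) p := fun p a =>
    (Polynomial.aeval_algHom_apply (T : DanSurf K φ →ₐ[K] DanSurf K φ) a p).symm
  have hDTz : D (T (dz K φ)) = Polynomial.aeval (dx K φ) g * dx K φ := by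
    simp [hTz, hDz, hDx, Derivation.map_aeval]
  intro b
  induction b using DanSurf.induction with
  | algebraMap c => simp
  | add a b ha hb => simp [ha, hb]
  | mul a b ha hb => simp [ha, hb]
  | x => simp [hTx, hDx]
  | y =>
    apply dx_mul_left_cancel hφ₀
    have hD := congrArg D hTy
    simp only [Derivation.leibniz, Derivation.map_aeval, hDx, hDTz, smul_eq_mul, mul_zero,
      add_zero] at hD
    rw [hD, hDy, map_mul, hTaeval, hTaeval, hTx]
    ring
  | z => rw [hDTz, hDz, map_mul, hTaeval, hTx]
end
end

section
/- Let ρ be a K-algebra automorphism of B such that ρ(x) = x and ρ(z) = μz + (μ−1)a for some μ ∈ K* and a ∈ K. If ρ commutes with D, then μ = 1. -/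
noncomputable section

/-- A root `c` of `φ` gives a retraction of `B` onto `K[X]` with `x ↦ X`, `y ↦ 0`, `z ↦ c`. -/
def DanSurf.toPolynomial (K : Type*) [Field K] (φ : Polynomial K) (c : K) (hc : φ.IsRoot c) :
    DanSurf K φ →ₐ[K] Polynomial K :=
  Ideal.Quotient.liftₐ (danIdeal K φ)
    (MvPolynomial.aeval ![Polynomial.X, 0, algebraMap K (Polynomial K) c]) (by
      intro p hp
      obtain ⟨q, rfl⟩ := Ideal.mem_span_singleton'.mp hp
      have h : Polynomial.aeval (Polynomial.C c) φ = 0 := by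
        rw [← Polynomial.algebraMap_eq, Polynomial.aeval_algebraMap_apply,
          Polynomial.coe_aeval_eq_eval, hc.eq_zero, map_zero]
      simp [← Polynomial.aeval_algHom_apply, h])

theorem DanSurf.toPolynomial_dx (K : Type*) [Field K] (φ : Polynomial K) (c : K)
    (hc : φ.IsRoot c) : DanSurf.toPolynomial K φ c hc (dx K φ) = Polynomial.X := by
  refine (Ideal.Quotient.lift_mk _ _ _).trans ?_
  simp

/-- Let `ρ` be a `K`-algebra automorphism of `B = K[X,Y,Z]/(XY - φ(Z))`
with `ρ(x) = x` and `ρ(z) = μz + (μ−1)a` for some `μ ∈ K*`, `a ∈ K`.  If `ρ` commutes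
with the nonzero locally nilpotent derivation `D` (`D(x) = 0`, `D(y) = g(x)·φ'(z)`,
`D(z) = g(x)·x`), then `μ = 1`. -/
theorem rescaling_in_isotropy_is_trivial {K : Type*} [Field K] [IsAlgClosed K] [CharZero K]
    (φ : Polynomial K) (hφ : 1 < φ.natDegree) (g : Polynomial K) (hg : g ≠ 0)
    (D : Derivation K (DanSurf K φ) (DanSurf K φ))
    (hDx : D (dx K φ) = 0)
    (hDy : D (dy K φ) =
      Polynomial.aeval (dx K φ) g * Polynomial.aeval (dz K φ) (Polynomial.derivative φ))
    (hDz : D (dz K φ) = Polynomial.aeval (dx K φ) g * dx K φ)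
    (ρ : DanSurf K φ ≃ₐ[K] DanSurf K φ) (μ a : K) (hμ : μ ≠ 0)
    (hρx : ρ (dx K φ) = dx K φ)
    (hρz : ρ (dz K φ) = μ • dz K φ + algebraMap K (DanSurf K φ) ((μ - 1) * a))
    (hcomm : ∀ b, ρ (D b) = D (ρ b)) :
    μ = 1 := by
  obtain ⟨c, hc⟩ := IsAlgClosed.exists_root φ
    (Polynomial.degree_ne_of_natDegree_ne (by omega : φ.natDegree ≠ 0))
  have h := hcomm (dz K φ)
  rw [hDz, hρz, map_mul, ← Polynomial.aeval_algHom_apply ρ, hρx, map_add,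
    Derivation.map_smul, Derivation.map_algebraMap, add_zero, hDz] at h
  have h' := congrArg (DanSurf.toPolynomial K φ c hc) h
  rw [map_smul, map_mul, ← Polynomial.aeval_algHom_apply, DanSurf.toPolynomial_dx,
    Polynomial.aeval_X_left_apply] at h'
  have hne : g * Polynomial.X ≠ 0 := mul_ne_zero hg Polynomial.X_ne_zero
  exact (smul_left_injective K hne (by simpa using h')).symm
end
end

section
/- For λ ∈ K*, the hyperbolic rotation H_λ of B commutes with D if and only if g(X) = λⁿ·g(λX) in K[X]; in particular, if H_λ commutes with D then λ is a root of unity. -/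
noncomputable section

/-- The ideal `(XⁿY - φ(Z))` of `K[X,Y,Z]`. -/
def danIdealN (K : Type*) [Field K] (n : ℕ) (φ : Polynomial K) :
    Ideal (MvPolynomial (Fin 3) K) :=
  Ideal.span
    {MvPolynomial.X 0 ^ n * MvPolynomial.X 1 - Polynomial.aeval (MvPolynomial.X 2) φ}

/-- The Danielewski surface `B = K[X,Y,Z]/(XⁿY - φ(Z))`. -/
def DanSurfN (K : Type*) [Field K] (n : ℕ) (φ : Polynomial K) : Type _ :=
  MvPolynomial (Fin 3) K ⧸ danIdealN K n φ

instance (K : Type*) [Field K] (n : ℕ) (φ : Polynomial K) : CommRing (DanSurfN K n φ) :=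
  Ideal.Quotient.commRing _

instance (K : Type*) [Field K] (n : ℕ) (φ : Polynomial K) : Algebra K (DanSurfN K n φ) :=
  Ideal.Quotient.algebra _

/-- The image `x` of `X` in `B`. -/
def nx (K : Type*) [Field K] (n : ℕ) (φ : Polynomial K) : DanSurfN K n φ :=
  Ideal.Quotient.mk (danIdealN K n φ) (MvPolynomial.X 0)

/-- The image `y` of `Y` in `B`. -/
def ny (K : Type*) [Field K] (n : ℕ) (φ : Polynomial K) : DanSurfN K n φ :=
  Ideal.Quotient.mk (danIdealN K n φ) (MvPolynomial.X 1)

/-- The image `z` of `Z` in `B`. -/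
def nz (K : Type*) [Field K] (n : ℕ) (φ : Polynomial K) : DanSurfN K n φ :=
  Ideal.Quotient.mk (danIdealN K n φ) (MvPolynomial.X 2)

open Polynomial in
/-- A root `a` of `φ` gives a retraction of `B` onto `K[X]` sending `x, y, z` to `X, 0, a`. -/
theorem DanSurfN.exists_retraction {K : Type*} [Field K] {n : ℕ} {φ : Polynomial K} {a : K}
    (ha : φ.eval a = 0) : ∃ r : DanSurfN K n φ →ₐ[K] Polynomial K, r (nx K n φ) = X := by
  let f : MvPolynomial (Fin 3) K →ₐ[K] Polynomial K := MvPolynomial.aeval ![X, 0, C a]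
  have hf : ∀ p ∈ danIdealN K n φ, f p = 0 := by
    intro p hp
    have hle : danIdealN K n φ ≤ RingHom.ker f := by
      refine Ideal.span_le.2 (Set.singleton_subset_iff.2 ?_)
      have h : aeval (C a : Polynomial K) φ = 0 := by
        rw [← algebraMap_eq, aeval_algebraMap_apply, coe_aeval_eq_eval, ha, map_zero]
      simp [RingHom.mem_ker, f, ← aeval_algHom_apply, h]
    exact hle hp
  refine ⟨(Ideal.Quotient.liftₐ (danIdealN K n φ) f hf :), ?_⟩
  change f (MvPolynomial.X 0) = X
  simp [f]

/-- Polynomials in `x` are detected in `B` as soon as `φ` has a root. -/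
theorem DanSurfN.aeval_nx_injective {K : Type*} [Field K] {n : ℕ} {φ : Polynomial K} {a : K}
    (ha : φ.eval a = 0) : Function.Injective (Polynomial.aeval (R := K) (nx K n φ)) := by
  obtain ⟨r, hr⟩ := DanSurfN.exists_retraction (n := n) ha
  intro p q h
  simpa [← Polynomial.aeval_algHom_apply, hr] using congrArg r h

/-- An algebra endomorphism commutes with a derivation of `B` if it does so at `x, y, z`. -/
theorem DanSurfN.commute_of_generators {K : Type*} [Field K] {n : ℕ} {φ : Polynomial K}
    {D : Derivation K (DanSurfN K n φ) (DanSurfN K n φ)}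
    {H : DanSurfN K n φ →ₐ[K] DanSurfN K n φ}
    (hx : H (D (nx K n φ)) = D (H (nx K n φ))) (hy : H (D (ny K n φ)) = D (H (ny K n φ)))
    (hz : H (D (nz K n φ)) = D (H (nz K n φ))) (b : DanSurfN K n φ) :
    H (D b) = D (H b) := by
  let π : MvPolynomial (Fin 3) K →ₐ[K] DanSurfN K n φ :=
    (Ideal.Quotient.mkₐ K (danIdealN K n φ) :)
  obtain ⟨p, rfl⟩ : ∃ p, π p = b := Ideal.Quotient.mk_surjective b
  induction p using MvPolynomial.induction_on with
  | C c =>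
    have h : π (MvPolynomial.C c) = algebraMap K _ c := π.commutes c
    simp [h]
  | add p q hp hq => simp [hp, hq]
  | mul_X p i hp =>
    have hi : H (D (π (MvPolynomial.X i))) = D (H (π (MvPolynomial.X i))) := by
      fin_cases i
      exacts [hx, hy, hz]
    simp [hp, hi]

/-- A nonzero `g` with `g(X) = cⁿ g(cX)` forces `c` to be a root of unity. -/
theorem Polynomial.pow_eq_one_of_eq_C_mul_comp {K : Type*} [Field K] {n : ℕ} {g : Polynomial K}
    (hg : g ≠ 0) {c : K}
    (h : g = Polynomial.C (c ^ n) * g.comp (Polynomial.C c * Polynomial.X)) :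
    c ^ (n + g.natDegree) = 1 := by
  have h1 := congrArg (fun p => Polynomial.coeff p g.natDegree) h
  simp only [Polynomial.coeff_C_mul, Polynomial.comp_C_mul_X_coeff] at h1
  have h2 : g.coeff g.natDegree ≠ 0 := by simpa using hg
  apply mul_right_cancel₀ h2
  rw [pow_add]
  linear_combination -h1

/-- For `λ ∈ K*`, the hyperbolic rotation `H_λ` of
`B = K[X,Y,Z]/(XⁿY - φ(Z))` (`H_λ(x) = λx`, `H_λ(y) = λ⁻ⁿy`, `H_λ(z) = z`) commutes
with the locally nilpotent derivation `D` (`D(x) = 0`, `D(y) = g(x)·φ'(z)`,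
`D(z) = g(x)·xⁿ`, `g ≠ 0`) if and only if `g(X) = λⁿ·g(λX)` in `K[X]`; in particular,
if `H_λ` commutes with `D` then `λ` is a root of unity. -/
theorem hyperbolic_rotation_commutes_iff_xn {K : Type*} [Field K] [IsAlgClosed K] [CharZero K]
    (n : ℕ) (hn : 1 < n) (φ : Polynomial K) (hφ : 1 < φ.natDegree)
    (g : Polynomial K) (hg : g ≠ 0)
    (D : Derivation K (DanSurfN K n φ) (DanSurfN K n φ))
    (hDx : D (nx K n φ) = 0)
    (hDy : D (ny K n φ) =
      Polynomial.aeval (nx K n φ) g * Polynomial.aeval (nz K n φ) (Polynomial.derivative φ))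
    (hDz : D (nz K n φ) = Polynomial.aeval (nx K n φ) g * nx K n φ ^ n)
    (lam : K) (hlam : lam ≠ 0)
    (H : DanSurfN K n φ ≃ₐ[K] DanSurfN K n φ)
    (hHx : H (nx K n φ) = lam • nx K n φ)
    (hHy : H (ny K n φ) = (lam ^ n)⁻¹ • ny K n φ)
    (hHz : H (nz K n φ) = nz K n φ) :
    ((∀ b, H (D b) = D (H b)) ↔
      g = Polynomial.C (lam ^ n) * g.comp (Polynomial.C lam * Polynomial.X)) ∧
    ((∀ b, H (D b) = D (H b)) → ∃ m : ℕ, 1 ≤ m ∧ lam ^ m = 1) := by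
  obtain ⟨a, ha⟩ := IsAlgClosed.exists_root φ
    (Polynomial.natDegree_pos_iff_degree_pos.1 (by omega)).ne'
  have hHg : H (Polynomial.aeval (nx K n φ) g) = Polynomial.aeval (nx K n φ)
      (g.comp (Polynomial.C lam * Polynomial.X)) := by
    rw [← Polynomial.aeval_algHom_apply, hHx, Polynomial.aeval_comp]
    simp [Algebra.smul_def]
  have hHφ : H (Polynomial.aeval (nz K n φ) (Polynomial.derivative φ)) =
      Polynomial.aeval (nz K n φ) (Polynomial.derivative φ) := by
    rw [← Polynomial.aeval_algHom_apply, hHz]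
  have hiff : (∀ b, H (D b) = D (H b)) ↔
      g = Polynomial.C (lam ^ n) * g.comp (Polynomial.C lam * Polynomial.X) := by
    constructor
    · intro h
      have hz := h (nz K n φ)
      rw [hHz, hDz, map_mul, map_pow, hHg, hHx] at hz
      have hX : (Polynomial.X : Polynomial K) ^ n ≠ 0 := pow_ne_zero _ Polynomial.X_ne_zero
      apply mul_right_cancel₀ hX
      apply DanSurfN.aeval_nx_injective (n := n) ha
      simp only [map_mul, map_pow, Polynomial.aeval_X, Polynomial.aeval_C]
      rw [← hz, Algebra.smul_def, mul_pow]
      ring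
    · intro h
      have hgx : Polynomial.aeval (nx K n φ) g = algebraMap K _ (lam ^ n) *
          Polynomial.aeval (nx K n φ) (g.comp (Polynomial.C lam * Polynomial.X)) := by
        conv_lhs => rw [h]
        rw [map_mul, Polynomial.aeval_C]
      refine DanSurfN.commute_of_generators (H := H.toAlgHom) ?_ ?_ ?_
      · simp [hDx, hHx]
      · simp only [AlgEquiv.toAlgHom_apply]
        rw [hHy, D.map_smul, hDy, map_mul, hHg, hHφ, hgx, mul_assoc, ← Algebra.smul_def,
          inv_smul_smul₀ (pow_ne_zero n hlam)]
      · simp only [AlgEquiv.toAlgHom_apply]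
        rw [hHz, hDz, map_mul, map_pow, hHg, hHx, hgx, Algebra.smul_def, mul_pow, map_pow]
        ring
  exact ⟨hiff, fun h => ⟨n + g.natDegree, by omega,
    Polynomial.pow_eq_one_of_eq_C_mul_comp hg (hiff.1 h)⟩⟩
end
end

section
/- Let ρ be a K-algebra automorphism of B such that ρ(x) = x and ρ(z) = λz for some λ ∈ K*. If ρ commutes with D, then λ = 1. -/
noncomputable section

/-- A root `c` of `φ` gives the `K`-algebra map `B → K[T]`, `x ↦ T`, `y ↦ 0`, `z ↦ c`. -/
def evalAtRoot {K : Type*} [Field K] (n : ℕ) (φ : Polynomial K) (c : K) (hc : φ.IsRoot c) :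
    DanSurfN K n φ →ₐ[K] Polynomial K :=
  Ideal.Quotient.liftₐ (danIdealN K n φ)
    (MvPolynomial.aeval ![Polynomial.X, 0, Polynomial.C c]) (by
      intro a ha
      rw [← RingHom.mem_ker]
      refine (Ideal.span_le.2 ?_ : danIdealN K n φ ≤ _) ha
      rw [Set.singleton_subset_iff, SetLike.mem_coe, RingHom.mem_ker, map_sub, map_mul, map_pow,
        ← Polynomial.aeval_algHom_apply]
      simp only [MvPolynomial.aeval_X, Matrix.cons_val]
      rw [← Polynomial.algebraMap_eq, Polynomial.aeval_algebraMap_apply, Polynomial.coe_aeval_eq_eval,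
        hc.eq_zero]
      simp)

theorem evalAtRoot_nx {K : Type*} [Field K] (n : ℕ) (φ : Polynomial K) (c : K)
    (hc : φ.IsRoot c) : evalAtRoot n φ c hc (nx K n φ) = Polynomial.X :=
  MvPolynomial.aeval_X (R := K) ![Polynomial.X, 0, Polynomial.C c] 0

/-- Let `ρ` be a `K`-algebra automorphism of
`B = K[X,Y,Z]/(XⁿY - φ(Z))` with `ρ(x) = x` and `ρ(z) = λz` for some `λ ∈ K*`.  If
`ρ` commutes with the locally nilpotent derivation `D` (`D(x) = 0`,
`D(y) = g(x)·φ'(z)`, `D(z) = g(x)·xⁿ`, `g ≠ 0`), then `λ = 1`. -/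
theorem rescaling_in_isotropy_is_trivial_xn {K : Type*} [Field K] [IsAlgClosed K] [CharZero K]
    (n : ℕ) (hn : 1 < n) (φ : Polynomial K) (hφ : 1 < φ.natDegree)
    (g : Polynomial K) (hg : g ≠ 0)
    (D : Derivation K (DanSurfN K n φ) (DanSurfN K n φ))
    (hDx : D (nx K n φ) = 0)
    (hDy : D (ny K n φ) =
      Polynomial.aeval (nx K n φ) g * Polynomial.aeval (nz K n φ) (Polynomial.derivative φ))
    (hDz : D (nz K n φ) = Polynomial.aeval (nx K n φ) g * nx K n φ ^ n)
    (ρ : DanSurfN K n φ ≃ₐ[K] DanSurfN K n φ) (lam : K) (hlam : lam ≠ 0)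
    (hρx : ρ (nx K n φ) = nx K n φ)
    (hρz : ρ (nz K n φ) = lam • nz K n φ)
    (hcomm : ∀ b, ρ (D b) = D (ρ b)) :
    lam = 1 := by
  obtain ⟨c, hc⟩ := IsAlgClosed.exists_root φ
    (Polynomial.natDegree_pos_iff_degree_pos.1 (by omega)).ne'
  have h := hcomm (nz K n φ)
  rw [hρz, D.map_smul, hDz, map_mul, map_pow, hρx, ← Polynomial.aeval_algHom_apply, hρx] at h
  have h' := congrArg (evalAtRoot n φ c hc) h
  rw [map_smul, map_mul, map_pow, ← Polynomial.aeval_algHom_apply, evalAtRoot_nx,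
    Polynomial.aeval_X_left_apply] at h'
  have hne : g * Polynomial.X ^ n ≠ 0 := mul_ne_zero hg (pow_ne_zero _ Polynomial.X_ne_zero)
  exact smul_left_injective K hne (by simpa using h'.symm)
end
end

section
/- Let B = K[X,Y,Z]/(X²Y − φ(Z)) and let D be the K-derivation of B determined by D(x) = 0, D(y) = (x+1)·φ'(z), D(z) = (x+1)·x². Then for λ ∈ K*, the hyperbolic rotation H_λ (with H_λ(x) = λx, H_λ(y) = λ⁻²y, H_λ(z) = z) commutes with D if and only if λ = 1. -/
noncomputable section

/-- The point `(a, φ(0)/a², 0)` of the Danielewski surface, as an algebra homomorphism to `K`. -/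
def danPoint {K : Type*} [Field K] (φ : Polynomial K) (a : K) (ha : a ≠ 0) :
    DanSurfN K 2 φ →ₐ[K] K :=
  Ideal.Quotient.liftₐ (danIdealN K 2 φ)
    (MvPolynomial.aeval ![a, φ.eval 0 / a ^ 2, 0]) (fun p hp => by
      have hle : danIdealN K 2 φ ≤
          RingHom.ker (MvPolynomial.aeval (R := K) ![a, φ.eval 0 / a ^ 2, 0]) := by
        rw [danIdealN, Ideal.span_le, Set.singleton_subset_iff, SetLike.mem_coe,
          RingHom.mem_ker, map_sub, ← Polynomial.aeval_algHom_apply]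
        simp [mul_div_cancel₀, ha, Polynomial.aeval_def, Polynomial.eval₂_eq_eval_map]
      exact hle hp)

theorem danPoint_nx {K : Type*} [Field K] (φ : Polynomial K) (a : K) (ha : a ≠ 0) :
    danPoint φ a ha (nx K 2 φ) = a := by
  refine (Ideal.Quotient.lift_mk _ _ _).trans ?_
  simp

theorem DanSurfN.algHom_ext {K : Type*} [Field K] {n : ℕ} {φ : Polynomial K} {A : Type*}
    [CommRing A] [Algebra K A] {f g : DanSurfN K n φ →ₐ[K] A}
    (hx : f (nx K n φ) = g (nx K n φ)) (hy : f (ny K n φ) = g (ny K n φ))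
    (hz : f (nz K n φ) = g (nz K n φ)) : f = g := by
  refine Ideal.Quotient.algHom_ext K (MvPolynomial.algHom_ext fun i => ?_)
  fin_cases i
  exacts [hx, hy, hz]

/-- Let `B = K[X,Y,Z]/(X²Y - φ(Z))` and let `D` be the derivation
with `D(x) = 0`, `D(y) = (x+1)·φ'(z)`, `D(z) = (x+1)·x²`.  For `λ ∈ K*`, the
hyperbolic rotation `H_λ` (`H_λ(x) = λx`, `H_λ(y) = λ⁻²y`, `H_λ(z) = z`) commutes with
`D` if and only if `λ = 1`. -/
theorem hyperbolic_rotation_commutes_iff_eq_one {K : Type*}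
    [Field K] [IsAlgClosed K] [CharZero K]
    (φ : Polynomial K) (hφ : 1 < φ.natDegree)
    (D : Derivation K (DanSurfN K 2 φ) (DanSurfN K 2 φ))
    (hDx : D (nx K 2 φ) = 0)
    (hDy : D (ny K 2 φ) =
      (nx K 2 φ + 1) * Polynomial.aeval (nz K 2 φ) (Polynomial.derivative φ))
    (hDz : D (nz K 2 φ) = (nx K 2 φ + 1) * nx K 2 φ ^ 2)
    (lam : K) (hlam : lam ≠ 0)
    (H : DanSurfN K 2 φ ≃ₐ[K] DanSurfN K 2 φ)
    (hHx : H (nx K 2 φ) = lam • nx K 2 φ)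
    (hHy : H (ny K 2 φ) = (lam ^ 2)⁻¹ • ny K 2 φ)
    (hHz : H (nz K 2 φ) = nz K 2 φ) :
    (∀ b, H (D b) = D (H b)) ↔ lam = 1 := by
  constructor
  · intro h
    have hz := h (nz K 2 φ)
    rw [hHz, hDz, map_mul, map_pow, map_add, map_one, hHx] at hz
    have hpt (a : K) (ha : a ≠ 0) : (lam * a + 1) * (lam * a) ^ 2 = (a + 1) * a ^ 2 := by
      simpa [danPoint_nx] using congrArg (danPoint φ a ha) hz
    have h1 := hpt 1 one_ne_zero
    have h2 := hpt (-1) (neg_ne_zero.mpr one_ne_zero)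
    have hsq : lam ^ 2 = 1 := by
      apply mul_left_cancel₀ (two_ne_zero (α := K))
      linear_combination h1 + h2
    linear_combination h1 - (lam + 1) * hsq
  · rintro rfl
    have hH : (H : DanSurfN K 2 φ →ₐ[K] DanSurfN K 2 φ) = AlgHom.id K _ :=
      DanSurfN.algHom_ext (by simpa using hHx) (by simpa using hHy) (by simpa using hHz)
    have hid (b) : H b = b := DFunLike.congr_fun hH b
    intro b
    rw [hid, hid]
end
end

section
/- A K-derivation D of B is locally nilpotent (i.e., for every b ∈ B there exists m ≥ 0 with Dᵐ(b) = 0) if and only if there exists g(X) ∈ K[X] such that D(x) = 0, D(y) = g(x)·φ'(z) and D(z) = g(x)·f(x). -/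
noncomputable section

/-- The ideal `(f(X)Y - φ(Z))` of `K[X,Y,Z]`. -/
def danIdealF (K : Type*) [Field K] (f φ : Polynomial K) :
    Ideal (MvPolynomial (Fin 3) K) :=
  Ideal.span
    {Polynomial.aeval (MvPolynomial.X 0) f * MvPolynomial.X 1 -
      Polynomial.aeval (MvPolynomial.X 2) φ}

/-- The Danielewski surface `B = K[X,Y,Z]/(f(X)Y - φ(Z))`. -/
def DanSurfF (K : Type*) [Field K] (f φ : Polynomial K) : Type _ :=
  MvPolynomial (Fin 3) K ⧸ danIdealF K f φ

instance (K : Type*) [Field K] (f φ : Polynomial K) : CommRing (DanSurfF K f φ) :=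
  Ideal.Quotient.commRing _

instance (K : Type*) [Field K] (f φ : Polynomial K) : Algebra K (DanSurfF K f φ) :=
  Ideal.Quotient.algebra _

/-- The image `x` of `X` in `B`. -/
def fx (K : Type*) [Field K] (f φ : Polynomial K) : DanSurfF K f φ :=
  Ideal.Quotient.mk (danIdealF K f φ) (MvPolynomial.X 0)

/-- The image `y` of `Y` in `B`. -/
def fy (K : Type*) [Field K] (f φ : Polynomial K) : DanSurfF K f φ :=
  Ideal.Quotient.mk (danIdealF K f φ) (MvPolynomial.X 1)

/-- The image `z` of `Z` in `B`. -/
def fz (K : Type*) [Field K] (f φ : Polynomial K) : DanSurfF K f φ :=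
  Ideal.Quotient.mk (danIdealF K f φ) (MvPolynomial.X 2)

/-- The Hahn series `s` vanishes below `γ` and has coefficient `c` at `γ`; here `c` may be `0`. -/
def HahnSeries.HasLead {Γ R : Type*} [PartialOrder Γ] [Zero R] (s : HahnSeries Γ R) (γ : Γ)
    (c : R) : Prop :=
  (∀ a < γ, s.coeff a = 0) ∧ s.coeff γ = c

namespace HahnSeries.HasLead

variable {Γ R : Type*} [LinearOrder Γ] [Field R]
  {s t : HahnSeries Γ R} {γ γ' : Γ} {c c' : R}

theorem ne_zero (h : s.HasLead γ c) (hc : c ≠ 0) : s ≠ 0 := by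
  rintro rfl
  exact hc (by simpa using h.2.symm)

theorem of_single (γ : Γ) (c : R) : (single γ c).HasLead γ c :=
  ⟨fun _ ha => coeff_single_of_ne ha.ne, coeff_single_same _ _⟩

theorem add (hs : s.HasLead γ c) (ht : t.HasLead γ c') : (s + t).HasLead γ (c + c') :=
  ⟨fun a ha => by simp [hs.1 a ha, ht.1 a ha], by simp [hs.2, ht.2]⟩

theorem const_smul (hs : s.HasLead γ c) (r : R) : (r • s).HasLead γ (r * c) :=
  ⟨fun a ha => by simp [hs.1 a ha], by simp [hs.2]⟩

theorem eq_of_ne_zero (hs : s.HasLead γ c) (hc : c ≠ 0) (hs' : s.HasLead γ' c') (hc' : c' ≠ 0) :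
    γ = γ' := by
  rcases lt_trichotomy γ γ' with h | h | h
  · exact absurd (hs.2.symm.trans (hs'.1 _ h)) hc
  · exact h
  · exact absurd (hs'.2.symm.trans (hs.1 _ h)) hc'

/-- Two series, not both zero, have a common lower bound for their exponents that is attained. -/
theorem exists_common (h : s ≠ 0 ∨ t ≠ 0) :
    ∃ γ c c', s.HasLead γ c ∧ t.HasLead γ c' ∧ (c ≠ 0 ∨ c' ≠ 0) := by
  have hwf : (s.support ∪ t.support).IsWF := s.isWF_support.union t.isWF_support
  have hne : (s.support ∪ t.support).Nonempty :=
    h.elim (fun h => (support_nonempty_iff.2 h).inl) fun h => (support_nonempty_iff.2 h).inr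
  have hlt : ∀ a < hwf.min hne, a ∉ s.support ∪ t.support :=
    fun a ha hmem => hwf.not_lt_min hne hmem ha
  refine ⟨hwf.min hne, _, _, ⟨fun a ha => ?_, rfl⟩, ⟨fun a ha => ?_, rfl⟩, hwf.min_mem hne⟩
  · by_contra h0
    exact hlt a ha (Or.inl h0)
  · by_contra h0
    exact hlt a ha (Or.inr h0)

variable [AddCommGroup Γ]

theorem order_leadingCoeff (s : HahnSeries Γ R) : s.HasLead s.order (s.coeff s.order) :=
  ⟨fun _ ha => coeff_eq_zero_of_lt_order ha, rfl⟩

variable [IsOrderedAddMonoid Γ]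

theorem mul (hs : s.HasLead γ c) (ht : t.HasLead γ' c') : (s * t).HasLead (γ + γ') (c * c') := by
  have key : ∀ i j : Γ, s.coeff i ≠ 0 → t.coeff j ≠ 0 → γ ≤ i ∧ γ' ≤ j := fun i j hi hj =>
    ⟨not_lt.1 fun h => hi (hs.1 _ h), not_lt.1 fun h => hj (ht.1 _ h)⟩
  constructor
  · intro a ha
    rw [coeff_mul]
    refine Finset.sum_eq_zero fun ij hij => ?_
    rw [Finset.mem_antidiagonal] at hij
    obtain ⟨h1, h2⟩ := key _ _ hij.1 hij.2.1
    exact absurd (hij.2.2 ▸ add_le_add h1 h2) (not_le.2 ha)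
  · rw [coeff_mul, Finset.sum_eq_single (γ, γ')]
    · rw [hs.2, ht.2]
    · rintro ⟨i, j⟩ hij hne
      rw [Finset.mem_antidiagonal] at hij
      obtain ⟨h1, h2⟩ := key _ _ hij.1 hij.2.1
      have h3 : i + j = γ + γ' := hij.2.2
      simp only at h1 h2
      obtain ⟨rfl, rfl⟩ := (add_eq_add_iff_eq_and_eq h1 h2).1 h3.symm
      exact absurd rfl hne
    · intro h
      rw [Finset.mem_antidiagonal] at h
      simp only [mem_support, and_true] at h
      by_cases h1 : s.coeff γ = 0
      · simp [h1]
      · have h2 : t.coeff γ' = 0 := by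
          by_contra h2
          exact h ⟨h1, h2⟩
        simp [h2]

theorem pow (hs : s.HasLead γ c) (n : ℕ) : (s ^ n).HasLead (n • γ) (c ^ n) := by
  induction n with
  | zero => simpa using of_single (0 : Γ) (1 : R)
  | succ n ih => simpa [pow_succ, succ_nsmul] using ih.mul hs

/-- Leading terms of cofactors in a product. -/
theorem of_mul (hs : s.HasLead γ c) (hc : c ≠ 0) (hst : (s * t).HasLead γ' c') (hc' : c' ≠ 0) :
    t.HasLead (γ' - γ) (c' / c) := by
  have ht : t ≠ 0 := right_ne_zero_of_mul (hst.ne_zero hc')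
  have hlt := order_leadingCoeff t
  have h0 : t.coeff t.order ≠ 0 := by rwa [Ne, coeff_order_eq_zero]
  have hm := hs.mul hlt
  have e := hm.eq_of_ne_zero (mul_ne_zero hc h0) hst hc'
  have e2 : c * t.coeff t.order = c' := by rw [← hm.2, e, hst.2]
  rw [← e, ← e2, add_sub_cancel_left, mul_div_cancel_left₀ _ hc]
  exact hlt

/-- The leading term of a polynomial in a monomial of negative exponent. -/
theorem aeval_single (hγ : γ < 0) (p : Polynomial R) :
    (Polynomial.aeval (single γ (1 : R)) p).HasLead (p.natDegree • γ) p.leadingCoeff := by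
  have e : ∀ a, (Polynomial.aeval (single γ (1 : R)) p).coeff a =
      ∑ i ∈ Finset.range (p.natDegree + 1), p.coeff i * (single (i • γ) (1 : R)).coeff a := by
    intro a
    rw [Polynomial.aeval_eq_sum_range, coeff_sum]
    simp [single_pow]
  have hlt : ∀ i < p.natDegree, p.natDegree • γ < i • γ := fun i hi => by
    simpa using (nsmul_lt_nsmul_iff_left (neg_pos.2 hγ)).2 hi
  constructor
  · intro a ha
    rw [e]
    refine Finset.sum_eq_zero fun i hi => ?_
    rcases (Nat.lt_succ_iff.1 (Finset.mem_range.1 hi)).lt_or_eq with h | h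
    · rw [coeff_single_of_ne (ha.trans (hlt i h)).ne, mul_zero]
    · rw [coeff_single_of_ne (h ▸ ha.ne), mul_zero]
  · rw [e, Finset.sum_range_succ, Finset.sum_eq_zero]
    · rw [coeff_single_same, mul_one, zero_add, Polynomial.leadingCoeff]
    · intro i hi
      rw [coeff_single_of_ne (hlt i (Finset.mem_range.1 hi)).ne, mul_zero]

end HahnSeries.HasLead

namespace HahnSeries

variable {Γ R : Type*} [AddCommGroup Γ] [LinearOrder Γ] [Field R]

/-- The Euler operator multiplying the coefficient at `γ` by `ℓ γ`. -/
def euler (ℓ : Γ →+ R) (s : HahnSeries Γ R) : HahnSeries Γ R where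
  coeff γ := ℓ γ * s.coeff γ
  isPWO_support' := s.isPWO_support.mono fun _ h => right_ne_zero_of_mul h

variable (ℓ : Γ →+ R) (s t : HahnSeries Γ R)

@[simp]
theorem coeff_euler (γ : Γ) : (euler ℓ s).coeff γ = ℓ γ * s.coeff γ := rfl

theorem euler_add : euler ℓ (s + t) = euler ℓ s + euler ℓ t := by
  ext γ
  simp [mul_add]

theorem euler_single (γ : Γ) (c : R) : euler ℓ (single γ c) = single γ (ℓ γ * c) := by
  ext a
  by_cases h : a = γ
  · subst h
    simp
  · simp [coeff_single_of_ne h]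

variable {s} in
theorem HasLead.euler {γ : Γ} {c : R} (hs : s.HasLead γ c) :
    (HahnSeries.euler ℓ s).HasLead γ (ℓ γ * c) :=
  ⟨fun a ha => by simp [hs.1 a ha], by simp [hs.2]⟩

variable [IsOrderedAddMonoid Γ]

theorem euler_mul : euler ℓ (s * t) = s * euler ℓ t + t * euler ℓ s := by
  have hsub : ∀ u : HahnSeries Γ R, (euler ℓ u).support ⊆ u.support :=
    fun u _ h => right_ne_zero_of_mul h
  ext γ
  rw [mul_comm t, coeff_add, coeff_mul_right' t.isPWO_support (hsub t),
    coeff_mul_left' s.isPWO_support (hsub s), coeff_euler, coeff_mul, Finset.mul_sum,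
    ← Finset.sum_add_distrib]
  refine Finset.sum_congr rfl fun ij hij => ?_
  rw [Finset.mem_antidiagonal] at hij
  rw [← hij.2.2, map_add, coeff_euler, coeff_euler]
  ring

theorem euler_algebraMap (c : R) : euler ℓ (algebraMap R (HahnSeries Γ R) c) = 0 := by
  rw [algebraMap_apply, C_apply, euler_single]
  simp

end HahnSeries

namespace DanSurfF

open HahnSeries Polynomial

variable {K : Type*} [Field K] {f φ : K[X]}

theorem relation (f φ : K[X]) : aeval (fx K f φ) f * fy K f φ = aeval (fz K f φ) φ := by
  have hx : aeval (fx K f φ) f =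
      Ideal.Quotient.mk (danIdealF K f φ) (aeval (MvPolynomial.X 0) f) :=
    aeval_algHom_apply (Ideal.Quotient.mkₐ K (danIdealF K f φ)) (MvPolynomial.X 0) f
  have hz : aeval (fz K f φ) φ =
      Ideal.Quotient.mk (danIdealF K f φ) (aeval (MvPolynomial.X 2) φ) :=
    aeval_algHom_apply (Ideal.Quotient.mkₐ K (danIdealF K f φ)) (MvPolynomial.X 2) φ
  rw [hx, hz]
  refine Eq.trans (map_mul _ _ _).symm ?_
  exact Ideal.Quotient.eq.2 (Ideal.subset_span rfl)

/-- Induction over the generators of `B`. -/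
theorem induction_on {C : DanSurfF K f φ → Prop} (b : DanSurfF K f φ)
    (const : ∀ a : K, C (algebraMap K _ a)) (hx : C (fx K f φ)) (hy : C (fy K f φ))
    (hz : C (fz K f φ)) (add : ∀ a b, C a → C b → C (a + b))
    (mul : ∀ a b, C a → C b → C (a * b)) : C b := by
  obtain ⟨p, rfl⟩ := Ideal.Quotient.mk_surjective b
  induction p using MvPolynomial.induction_on with
  | C a => exact const a
  | add p q hp hq => exact (map_add (Ideal.Quotient.mk (danIdealF K f φ)) p q) ▸ add _ _ hp hq
  | mul_X p i hp =>
    refine (map_mul (Ideal.Quotient.mk (danIdealF K f φ)) p _) ▸ mul _ _ hp ?_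
    fin_cases i
    exacts [hx, hy, hz]

/-- The image of `x` in the field of iterated Laurent series in `1/z` and `1/x`. -/
def serX (K : Type*) [Field K] : HahnSeries (ℤ ×ₗ ℤ) K := single (toLex (0, -1)) 1

/-- The image of `z` in the field of iterated Laurent series in `1/z` and `1/x`. -/
def serZ (K : Type*) [Field K] : HahnSeries (ℤ ×ₗ ℤ) K := single (toLex (-1, 0)) 1

theorem hasLead_aeval_serX (p : K[X]) :
    (aeval (serX K) p).HasLead (toLex (0, -(p.natDegree : ℤ))) p.leadingCoeff := by
  have h : (toLex (0, -1) : ℤ ×ₗ ℤ) < 0 := by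
    rw [Prod.Lex.lt_iff]; simp
  have e : p.natDegree • (toLex (0, -1) : ℤ ×ₗ ℤ) = toLex (0, -(p.natDegree : ℤ)) := by
    rw [← ofLex_inj]; ext <;> simp
  exact e ▸ HasLead.aeval_single h p

theorem hasLead_aeval_serZ (p : K[X]) :
    (aeval (serZ K) p).HasLead (toLex (-(p.natDegree : ℤ), 0)) p.leadingCoeff := by
  have h : (toLex (-1, 0) : ℤ ×ₗ ℤ) < 0 := by
    rw [Prod.Lex.lt_iff]; simp
  have e : p.natDegree • (toLex (-1, 0) : ℤ ×ₗ ℤ) = toLex (-(p.natDegree : ℤ), 0) := by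
    rw [← ofLex_inj]; ext <;> simp
  exact e ▸ HasLead.aeval_single h p

theorem aeval_serX_ne_zero {p : K[X]} (hp : p ≠ 0) : aeval (serX K) p ≠ 0 :=
  (hasLead_aeval_serX p).ne_zero (leadingCoeff_ne_zero.2 hp)

/-- The embedding of `B` into iterated Laurent series in `1/z` and `1/x`. -/
def toSeries (φ : K[X]) (hf : f ≠ 0) : DanSurfF K f φ →ₐ[K] HahnSeries (ℤ ×ₗ ℤ) K :=
  Ideal.Quotient.liftₐ (danIdealF K f φ)
    (MvPolynomial.aeval ![serX K, aeval (serZ K) φ / aeval (serX K) f, serZ K]) <| by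
    suffices h : danIdealF K f φ ≤ RingHom.ker
        (MvPolynomial.aeval (R := K) ![serX K, aeval (serZ K) φ / aeval (serX K) f, serZ K]) from
      fun a ha => h ha
    refine (Ideal.span_singleton_le_iff_mem _).2 ?_
    rw [RingHom.mem_ker, map_sub, map_mul, ← aeval_algHom_apply, ← aeval_algHom_apply]
    simp only [MvPolynomial.aeval_X]
    exact sub_eq_zero.2 (mul_div_cancel₀ _ (aeval_serX_ne_zero hf))

variable (hf : f ≠ 0)

@[simp]
theorem toSeries_fx : toSeries φ hf (fx K f φ) = serX K :=
  (Ideal.Quotient.liftₐ_apply _ _ _ _).trans (MvPolynomial.aeval_X _ 0)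

@[simp]
theorem toSeries_fz : toSeries φ hf (fz K f φ) = serZ K :=
  (Ideal.Quotient.liftₐ_apply _ _ _ _).trans (MvPolynomial.aeval_X _ 2)

theorem hasLead_toSeries_fy (hφ : φ ≠ 0) :
    (toSeries φ hf (fy K f φ)).HasLead (toLex (-(φ.natDegree : ℤ), (f.natDegree : ℤ)))
      (φ.leadingCoeff / f.leadingCoeff) := by
  have h := congrArg (toSeries φ hf) (relation f φ)
  rw [map_mul, ← aeval_algHom_apply, ← aeval_algHom_apply, toSeries_fx, toSeries_fz] at h
  have := (hasLead_aeval_serX f).of_mul (leadingCoeff_ne_zero.2 hf)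
    (h ▸ hasLead_aeval_serZ φ) (leadingCoeff_ne_zero.2 hφ)
  have e : (toLex (-(φ.natDegree : ℤ), 0) - toLex (0, -(f.natDegree : ℤ)) : ℤ ×ₗ ℤ) =
      toLex (-(φ.natDegree : ℤ), (f.natDegree : ℤ)) := by
    rw [← ofLex_inj]; ext <;> simp
  exact e ▸ this

/-- The monomials `x ^ i * y ^ j * z ^ k` with `k < deg φ`. -/
def mon (f φ : K[X]) (u : ℕ × ℕ × Fin φ.natDegree) : DanSurfF K f φ :=
  fx K f φ ^ u.1 * fy K f φ ^ u.2.1 * fz K f φ ^ (u.2.2 : ℕ)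

/-- The exponent of the leading term of `mon f φ u`. -/
def monExp (f φ : K[X]) (u : ℕ × ℕ × Fin φ.natDegree) : ℤ ×ₗ ℤ :=
  toLex (-((φ.natDegree : ℤ) * u.2.1 + (u.2.2 : ℕ)), (f.natDegree : ℤ) * u.2.1 - u.1)

theorem monExp_injective : Function.Injective (monExp f φ) := by
  rintro ⟨i, j, k⟩ ⟨i', j', k'⟩ h
  have h' : (φ.natDegree : ℤ) * j + (k : ℕ) = φ.natDegree * j' + (k' : ℕ) ∧
      (f.natDegree : ℤ) * j - i = f.natDegree * j' - i' :=
    ⟨neg_injective (congrArg (fun e => (ofLex e).1) h), congrArg (fun e => (ofLex e).2) h⟩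
  obtain ⟨h1, h2⟩ := h'
  have h1' : φ.natDegree * j + (k : ℕ) = φ.natDegree * j' + (k' : ℕ) := by exact_mod_cast h1
  have hk : (k : ℕ) = k' := by
    have := congrArg (· % φ.natDegree) h1'
    simpa [Nat.mul_add_mod, Nat.mod_eq_of_lt k.2, Nat.mod_eq_of_lt k'.2] using this
  have hj : j = j' := by
    rw [hk] at h1'
    exact Nat.eq_of_mul_eq_mul_left k.pos (Nat.add_right_cancel h1')
  subst hj
  have hi : i = i' := by omega
  rw [hi, Fin.ext hk]

theorem hasLead_mon (hφ : φ ≠ 0) (u : ℕ × ℕ × Fin φ.natDegree) :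
    ∃ a ≠ 0, (toSeries φ hf (mon f φ u)).HasLead (monExp f φ u) a := by
  refine ⟨(1 ^ u.1 * (φ.leadingCoeff / f.leadingCoeff) ^ u.2.1) * 1 ^ (u.2.2 : ℕ), ?_, ?_⟩
  · simp [hφ, hf]
  · rw [mon, map_mul, map_mul, map_pow, map_pow, map_pow, toSeries_fx, toSeries_fz]
    have e : u.1 • (toLex (0, -1) : ℤ ×ₗ ℤ) +
        u.2.1 • toLex (-(φ.natDegree : ℤ), (f.natDegree : ℤ)) +
        (u.2.2 : ℕ) • toLex (-1, 0) = monExp f φ u := by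
      rw [← ofLex_inj]
      ext <;> simp [monExp] <;> ring
    exact e ▸ (((HasLead.of_single _ _).pow _).mul ((hasLead_toSeries_fy hf hφ).pow _)).mul
      ((HasLead.of_single _ _).pow _)

/-- If `A = K[x, y, z]` with `f(x) * y = φ(z)`, then `A` is spanned by the monomials of degree less
than `deg φ` in `z`. -/
theorem span_monomials_eq_top {A : Type*} [CommRing A] [Algebra K A] {x y z : A}
    (h : aeval x f * y = aeval z φ) (hA : Algebra.adjoin K {x, y, z} = ⊤)
    (hφ : 0 < φ.natDegree) :
    Submodule.span K (Set.range fun u : ℕ × ℕ × Fin φ.natDegree =>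
      x ^ u.1 * y ^ u.2.1 * z ^ (u.2.2 : ℕ)) = ⊤ := by
  set mon : ℕ × ℕ × Fin φ.natDegree → A :=
    fun u => x ^ u.1 * y ^ u.2.1 * z ^ (u.2.2 : ℕ) with hmon
  set M := Submodule.span K (Set.range mon) with hM
  have mul_of : ∀ b, (∀ u, b * mon u ∈ M) → ∀ w ∈ M, b * w ∈ M := by
    intro b hb w hw
    have : M ≤ M.comap (LinearMap.mulLeft K b) := by
      rw [hM, Submodule.span_le]
      rintro _ ⟨u, rfl⟩
      exact hb u
    exact this hw
  have hx : ∀ w ∈ M, x * w ∈ M := mul_of _ fun ⟨i, j, k⟩ =>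
    Submodule.subset_span ⟨(i + 1, j, k), by simp only [hmon]; ring⟩
  have hy : ∀ w ∈ M, y * w ∈ M := mul_of _ fun ⟨i, j, k⟩ =>
    Submodule.subset_span ⟨(i, j + 1, k), by simp only [hmon]; ring⟩
  have hfx : ∀ p : K[X], ∀ w ∈ M, aeval x p * w ∈ M := by
    intro p w hw
    induction p using Polynomial.induction_on' with
    | add p q hp hq => rw [map_add, add_mul]; exact M.add_mem hp hq
    | monomial n a =>
      rw [aeval_monomial, ← Algebra.smul_def, smul_mul_assoc]
      refine M.smul_mem _ ?_
      induction n with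
      | zero => simpa using hw
      | succ n ih => rw [pow_succ', mul_assoc]; exact hx _ ih
  have hz : ∀ w ∈ M, z * w ∈ M := mul_of _ <| by
    rintro ⟨i, j, k, hk⟩
    by_cases hk' : k + 1 < φ.natDegree
    · exact Submodule.subset_span ⟨(i, j, ⟨k + 1, hk'⟩), by simp only [hmon]; ring⟩
    · have hk1 : k + 1 = φ.natDegree := by omega
      set w := x ^ i * y ^ j with hw
      have hwk : ∀ l < φ.natDegree, w * z ^ l ∈ M := fun l hl =>
        Submodule.subset_span ⟨(i, j, ⟨l, hl⟩), rfl⟩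
      have h0 : w ∈ M := by simpa using hwk 0 hφ
      have e : φ.leadingCoeff • (w * z ^ φ.natDegree) =
          aeval x f * (y * w) -
            ∑ l ∈ Finset.range φ.natDegree, φ.coeff l • (w * z ^ l) := by
        rw [← mul_assoc, h, aeval_eq_sum_range, Finset.sum_range_succ, add_mul,
          Finset.sum_mul]
        simp only [smul_mul_assoc, mul_comm w, Polynomial.leadingCoeff]
        ring
      have hm : φ.leadingCoeff • (w * z ^ φ.natDegree) ∈ M := by
        rw [e]
        refine M.sub_mem (hfx _ _ (hy _ h0)) (M.sum_mem fun l hl => M.smul_mem _ ?_)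
        exact hwk l (Finset.mem_range.1 hl)
      have hne : φ.leadingCoeff ≠ 0 := leadingCoeff_ne_zero.2 (ne_zero_of_natDegree_gt hφ)
      have e2 : z * mon (i, j, ⟨k, hk⟩) = w * z ^ φ.natDegree := by
        simp only [hmon, ← hk1, hw]; ring
      rw [e2]
      exact (Submodule.smul_mem_iff _ hne).1 hm
  have key : ∀ b : A, ∀ w ∈ M, b * w ∈ M := by
    intro b
    induction (hA ▸ Algebra.mem_top : b ∈ Algebra.adjoin K {x, y, z}) using
      Algebra.adjoin_induction with
    | mem b hb =>
      rcases hb with rfl | rfl | rfl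
      exacts [hx, hy, hz]
    | algebraMap a => intro w hw; rw [← Algebra.smul_def]; exact M.smul_mem _ hw
    | add a b _ _ ha hb => intro w hw; rw [add_mul]; exact M.add_mem (ha w hw) (hb w hw)
    | mul a b _ _ ha hb => intro w hw; rw [mul_assoc]; exact ha _ (hb w hw)
  refine eq_top_iff.2 fun b _ => ?_
  have h1 : (1 : A) ∈ M := Submodule.subset_span ⟨(0, 0, ⟨0, hφ⟩), by simp [hmon]⟩
  simpa using key b 1 h1

theorem adjoin_eq_top (f φ : K[X]) :
    Algebra.adjoin K {fx K f φ, fy K f φ, fz K f φ} = ⊤ := by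
  refine Algebra.eq_top_iff.2 fun b => ?_
  induction b using induction_on with
  | const a => exact Subalgebra.algebraMap_mem _ a
  | hx => exact Algebra.subset_adjoin (by simp)
  | hy => exact Algebra.subset_adjoin (by simp)
  | hz => exact Algebra.subset_adjoin (by simp)
  | add a b ha hb => exact Subalgebra.add_mem _ ha hb
  | mul a b ha hb => exact Subalgebra.mul_mem _ ha hb

theorem mon_span (f : K[X]) (hφ : 0 < φ.natDegree) :
    Submodule.span K (Set.range (mon f φ)) = ⊤ :=
  span_monomials_eq_top (relation f φ) (adjoin_eq_top f φ) hφ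

/-- A nonzero element of `B` has an expansion in monomials, whose leading term is that of exactly
one of the monomials. -/
theorem exists_expansion (hφ : 0 < φ.natDegree) {b : DanSurfF K f φ} (hb : b ≠ 0) :
    ∃ (c : (ℕ × ℕ × Fin φ.natDegree) →₀ K) (u₀ : ℕ × ℕ × Fin φ.natDegree) (a : K),
      (c.sum fun u r => r • mon f φ u) = b ∧ a ≠ 0 ∧
      (toSeries φ hf b).HasLead (monExp f φ u₀) a ∧
      ∀ u ∈ c.support, monExp f φ u₀ ≤ monExp f φ u := by
  obtain ⟨c, hc⟩ := Finsupp.mem_span_range_iff_exists_finsupp.1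
    ((mon_span f hφ).symm ▸ Submodule.mem_top : b ∈ Submodule.span K (Set.range (mon f φ)))
  have hne : c.support.Nonempty := by
    rw [Finset.nonempty_iff_ne_empty, Ne, Finsupp.support_eq_empty]
    rintro rfl
    exact hb (by simpa using hc.symm)
  obtain ⟨u₀, hu₀, hmin⟩ := c.support.exists_min_image (monExp f φ) hne
  have hφ0 : φ ≠ 0 := ne_zero_of_natDegree_gt hφ
  obtain ⟨a, ha, hlead⟩ := hasLead_mon hf hφ0 u₀
  refine ⟨c, u₀, c u₀ * a, hc, mul_ne_zero (Finsupp.mem_support_iff.1 hu₀) ha, ?_, hmin⟩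
  have e : ∀ g, (toSeries φ hf b).coeff g =
      ∑ u ∈ c.support, c u * (toSeries φ hf (mon f φ u)).coeff g := by
    intro g
    rw [← hc, Finsupp.sum, map_sum, HahnSeries.coeff_sum]
    simp
  have hz : ∀ u ∈ c.support, ∀ g < monExp f φ u, (toSeries φ hf (mon f φ u)).coeff g = 0 := by
    intro u _ g hg
    obtain ⟨a', -, h'⟩ := hasLead_mon hf hφ0 u
    exact h'.1 g hg
  constructor
  · intro g hg
    rw [e]
    exact Finset.sum_eq_zero fun u hu => by rw [hz u hu g (hg.trans_le (hmin u hu)), mul_zero]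
  · rw [e, Finset.sum_eq_single_of_mem u₀ hu₀, hlead.2]
    intro u hu hne'
    have : monExp f φ u₀ < monExp f φ u :=
      lt_of_le_of_ne (hmin u hu) fun h => hne' (monExp_injective h).symm
    rw [hz u hu _ this, mul_zero]

theorem toSeries_injective (hφ : 0 < φ.natDegree) : Function.Injective (toSeries φ hf) := by
  refine (injective_iff_map_eq_zero _).2 fun b hb => ?_
  by_contra h
  obtain ⟨-, u, a, -, ha, hlead, -⟩ := exists_expansion hf hφ h
  exact hlead.ne_zero ha hb

/-- Leading exponents of elements of `B` are leading exponents of monomials. -/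
theorem mem_range_monExp (hφ : 0 < φ.natDegree) {b : DanSurfF K f φ} {γ : ℤ ×ₗ ℤ} {c : K}
    (h : (toSeries φ hf b).HasLead γ c) (hc : c ≠ 0) : γ ∈ Set.range (monExp f φ) := by
  have hb : b ≠ 0 := by
    rintro rfl
    exact h.ne_zero hc (map_zero _)
  obtain ⟨-, u, a, -, ha, hlead, -⟩ := exists_expansion hf hφ hb
  exact ⟨u, hlead.eq_of_ne_zero ha h hc⟩

/-- An element of `B` of negative degree in `z` vanishes. -/
theorem eq_zero_of_hasLead (hφ : 0 < φ.natDegree) {b : DanSurfF K f φ} {γ : ℤ ×ₗ ℤ} {c : K}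
    (h : (toSeries φ hf b).HasLead γ c) (hγ : 0 < (ofLex γ).1) : b = 0 := by
  by_contra hb
  obtain ⟨-, u, a, -, ha, hlead, -⟩ := exists_expansion hf hφ hb
  refine ha (hlead.2.symm.trans (h.1 _ ?_))
  rw [Prod.Lex.lt_iff]
  left
  refine lt_of_le_of_lt ?_ hγ
  simp only [monExp, ofLex_toLex]
  have : (0 : ℤ) ≤ (φ.natDegree : ℤ) * u.2.1 + (u.2.2 : ℕ) := by positivity
  linarith

/-- An element of `B` of degree zero in `z` is a polynomial in `x`. -/
theorem exists_eq_aeval_of_hasLead (hφ : 0 < φ.natDegree) {b : DanSurfF K f φ} {γ : ℤ ×ₗ ℤ}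
    {c : K} (h : (toSeries φ hf b).HasLead γ c) (hγ : 0 ≤ (ofLex γ).1) :
    ∃ p : K[X], b = aeval (fx K f φ) p := by
  by_cases hb : b = 0
  · exact ⟨0, by simpa using hb⟩
  obtain ⟨r, u₀, a, hr, ha, hlead, hmin⟩ := exists_expansion hf hφ hb
  have hγ' : γ ≤ monExp f φ u₀ := not_lt.1 fun hlt => ha (hlead.2.symm.trans (h.1 _ hlt))
  refine ⟨∑ u ∈ r.support, monomial u.1 (r u), ?_⟩
  rw [← hr, map_sum, Finsupp.sum]
  refine Finset.sum_congr rfl fun u hu => ?_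
  have h1 : 0 ≤ (ofLex (monExp f φ u)).1 :=
    hγ.trans (Prod.Lex.monotone_fst _ _ (hγ'.trans (hmin u hu)))
  have h2 : (φ.natDegree : ℤ) * u.2.1 + (u.2.2 : ℕ) ≤ 0 := neg_nonneg.1 h1
  have h3 : φ.natDegree * u.2.1 + (u.2.2 : ℕ) = 0 := by
    have : φ.natDegree * u.2.1 + (u.2.2 : ℕ) ≤ 0 := by exact_mod_cast h2
    omega
  have h4 : u.2.1 = 0 := by
    have := (Nat.add_eq_zero_iff.1 h3).1
    exact (Nat.mul_eq_zero.1 this).resolve_left hφ.ne'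
  have h5 : (u.2.2 : ℕ) = 0 := (Nat.add_eq_zero_iff.1 h3).2
  rw [aeval_monomial, mon, h4, h5, Algebra.smul_def]
  simp

/-- A map `B → L` obeying the rules of a derivation is determined by its values at `x` and `z`. -/
theorem eq_zero_of_leibniz {Δ : DanSurfF K f φ → HahnSeries (ℤ ×ₗ ℤ) K}
    (const : ∀ a : K, Δ (algebraMap K _ a) = 0) (add : ∀ a b, Δ (a + b) = Δ a + Δ b)
    (mul : ∀ a b, Δ (a * b) = toSeries φ hf a * Δ b + toSeries φ hf b * Δ a)
    (hx : Δ (fx K f φ) = 0) (hz : Δ (fz K f φ) = 0) (b : DanSurfF K f φ) : Δ b = 0 := by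
  have hpoly : ∀ w, Δ w = 0 → ∀ p : K[X], Δ (aeval w p) = 0 := by
    intro w hw p
    induction p using Polynomial.induction_on' with
    | add p q hp hq => rw [map_add, add, hp, hq, add_zero]
    | monomial n a =>
      rw [aeval_monomial, mul, const, mul_zero, add_zero]
      have : Δ (w ^ n) = 0 := by
        induction n with
        | zero => simpa using const 1
        | succ n ih => rw [pow_succ, mul, ih, hw, mul_zero, mul_zero, add_zero]
      rw [this, mul_zero]
  induction b using induction_on with
  | const a => exact const a
  | hx => exact hx
  | hy =>
    have h := hpoly _ hz φ
    rw [← relation, mul, hpoly _ hx, mul_zero, add_zero, ← aeval_algHom_apply, toSeries_fx] at h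
    exact (mul_eq_zero.1 h).resolve_left (aeval_serX_ne_zero hf)
  | hz => exact hz
  | add a b ha hb => rw [add, ha, hb, add_zero]
  | mul a b ha hb => rw [mul, ha, hb, mul_zero, mul_zero, add_zero]

/-- The additive form `γ ↦ a * γ.1 + b * γ.2` on exponents. -/
def expForm (a b : K) : (ℤ ×ₗ ℤ) →+ K where
  toFun γ := a * (ofLex γ).1 + b * (ofLex γ).2
  map_zero' := by simp
  map_add' γ γ' := by
    simp only [ofLex_add, Prod.fst_add, Prod.snd_add]
    push_cast
    ring

theorem expForm_apply (a b : K) (γ : ℤ ×ₗ ℤ) :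
    expForm a b γ = a * (ofLex γ).1 + b * (ofLex γ).2 := rfl

/-- A derivation of `B` is a combination of Euler operators on iterated Laurent series. -/
theorem toSeries_derivation (D : Derivation K (DanSurfF K f φ) (DanSurfF K f φ))
    (b : DanSurfF K f φ) :
    toSeries φ hf (D b) =
      -(toSeries φ hf (D (fz K f φ)) / serZ K) * euler (expForm 1 0) (toSeries φ hf b) +
      -(toSeries φ hf (D (fx K f φ)) / serX K) * euler (expForm 0 1) (toSeries φ hf b) := by
  rw [← sub_eq_zero]
  have hX : serX K ≠ 0 := single_ne_zero one_ne_zero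
  have hZ : serZ K ≠ 0 := single_ne_zero one_ne_zero
  refine eq_zero_of_leibniz (Δ := fun b => toSeries φ hf (D b) - (_ * euler (expForm 1 0)
    (toSeries φ hf b) + _ * euler (expForm 0 1) (toSeries φ hf b))) hf ?_ ?_ ?_ ?_ ?_ b
  · intro a
    simp only [Derivation.map_algebraMap, map_zero, AlgHom.commutes, euler_algebraMap]
    ring
  · intro a b
    simp only [map_add, euler_add]
    ring
  · intro a b
    simp only [map_mul, map_add, euler_mul, Derivation.leibniz, smul_eq_mul]
    ring
  · have h1 : euler (expForm 1 0) (serX K) = 0 := by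
      rw [serX, euler_single, expForm_apply]; simp
    have h2 : euler (expForm 0 1) (serX K) = -serX K := by
      rw [serX, euler_single, expForm_apply]; simp
    simp only [toSeries_fx, h1, h2]
    field_simp
    ring
  · have h1 : euler (expForm 0 1) (serZ K) = 0 := by
      rw [serZ, euler_single, expForm_apply]; simp
    have h2 : euler (expForm 1 0) (serZ K) = -serZ K := by
      rw [serZ, euler_single, expForm_apply]; simp
    simp only [toSeries_fz, h1, h2]
    field_simp
    ring

section Nilpotent

variable {D : Derivation K (DanSurfF K f φ) (DanSurfF K f φ)}
  {P Q : HahnSeries (ℤ ×ₗ ℤ) K} {δ : ℤ ×ₗ ℤ} {α β : K}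

theorem hasLead_iterate
    (hD : ∀ b, toSeries φ hf (D b) = P * euler (expForm 1 0) (toSeries φ hf b) +
      Q * euler (expForm 0 1) (toSeries φ hf b))
    (hP : P.HasLead δ α) (hQ : Q.HasLead δ β) {b : DanSurfF K f φ} {γ : ℤ ×ₗ ℤ} {c : K}
    (h : (toSeries φ hf b).HasLead γ c) (k : ℕ) :
    (toSeries φ hf (D^[k] b)).HasLead (γ + k • δ)
      (c * ∏ i ∈ Finset.range k, (expForm α β γ + i * expForm α β δ)) := by
  induction k with
  | zero => simpa using h
  | succ k ih =>
    rw [Function.iterate_succ_apply', hD]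
    have := (hP.mul (ih.euler (expForm 1 0))).add (hQ.mul (ih.euler (expForm 0 1)))
    have e1 : γ + (k + 1) • δ = δ + (γ + k • δ) := by rw [succ_nsmul]; abel
    have e2 : expForm α β γ + k * expForm α β δ =
        α * expForm 1 0 (γ + k • δ) + β * expForm 0 1 (γ + k • δ) := by
      rw [map_add, map_add, map_nsmul, map_nsmul]
      simp only [expForm_apply, nsmul_eq_mul]
      ring
    have e3 : c * ∏ i ∈ Finset.range (k + 1), (expForm α β γ + i * expForm α β δ) =
        α * (expForm 1 0 (γ + k • δ) *
          (c * ∏ i ∈ Finset.range k, (expForm α β γ + i * expForm α β δ))) +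
        β * (expForm 0 1 (γ + k • δ) *
          (c * ∏ i ∈ Finset.range k, (expForm α β γ + i * expForm α β δ))) := by
      rw [Finset.prod_range_succ, e2]
      ring
    rw [e1, e3]
    exact this

/-- If `D` is nilpotent at `b`, its leading part is nilpotent at the leading monomial of `b`. -/
theorem exists_expForm_add_eq_zero (hφ : 0 < φ.natDegree)
    (hD : ∀ b, toSeries φ hf (D b) = P * euler (expForm 1 0) (toSeries φ hf b) +
      Q * euler (expForm 0 1) (toSeries φ hf b))
    (hP : P.HasLead δ α) (hQ : Q.HasLead δ β) {b : DanSurfF K f φ} {γ : ℤ ×ₗ ℤ} {c : K}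
    (h : (toSeries φ hf b).HasLead γ c) (hc : c ≠ 0) {N : ℕ} (hN : D^[N] b = 0) :
    ∃ t : ℕ, expForm α β γ + t * expForm α β δ = 0 ∧
      (1 ≤ t → γ + δ ∈ Set.range (monExp f φ)) := by
  by_cases h0 : expForm α β γ = 0
  · exact ⟨0, by simpa using h0, by simp⟩
  have h1 := hasLead_iterate hf hD hP hQ h 1
  simp only [Finset.prod_range_one, Nat.cast_zero, zero_mul, add_zero, one_smul] at h1
  have hN' := hasLead_iterate hf hD hP hQ h N
  rw [hN, map_zero] at hN'
  have : ∏ i ∈ Finset.range N, (expForm α β γ + i * expForm α β δ) = 0 := by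
    by_contra hne
    exact hN'.ne_zero (mul_ne_zero hc hne) rfl
  obtain ⟨t, -, ht⟩ := Finset.prod_eq_zero_iff.1 this
  exact ⟨t, ht, fun _ => mem_range_monExp hf hφ h1 (mul_ne_zero hc h0)⟩

end Nilpotent

/-- The only shifts of exponents that can come from a locally nilpotent derivation lower the degree
in `z` by one. -/
theorem shift_eq_one (hf' : 1 < f.natDegree) (hφ' : 1 < φ.natDegree) {p q r : ℕ} {d₁ d₂ : ℤ}
    (hd : p * d₂ + q * d₁ = 1) (hr : (f.natDegree : ℤ) * p + r = φ.natDegree * q)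
    (hx : 1 ≤ p → toLex (d₁, d₂ - 1) ∈ Set.range (monExp f φ))
    (hz : 1 ≤ q → toLex (d₁ - 1, d₂) ∈ Set.range (monExp f φ)) : p = 0 := by
  by_contra hp
  have hp1 : 1 ≤ p := Nat.one_le_iff_ne_zero.2 hp
  have hq1 : 1 ≤ q := by
    by_contra hq
    have hq0 : q = 0 := by omega
    subst hq0
    have : (0 : ℤ) < f.natDegree * p := by positivity
    push_cast at hr
    omega
  obtain ⟨⟨i, j, k, hk⟩, h1⟩ := hx hp1
  obtain ⟨⟨i', j', k', hk'⟩, h2⟩ := hz hq1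
  have h1a : -((φ.natDegree : ℤ) * j + k) = d₁ := congrArg (fun e => (ofLex e).1) h1
  have h1b : (f.natDegree : ℤ) * j - i = d₂ - 1 := congrArg (fun e => (ofLex e).2) h1
  have h2a : -((φ.natDegree : ℤ) * j' + k') = d₁ - 1 := congrArg (fun e => (ofLex e).1) h2
  have h2b : (f.natDegree : ℤ) * j' - i' = d₂ := congrArg (fun e => (ofLex e).2) h2
  clear hx hz h1 h2
  generalize f.natDegree = n at *
  generalize φ.natDegree = m at *
  have e1 : p * i + r * j + q * k + 1 = p := by
    zify
    obtain rfl : d₂ = n * j - i + 1 := by linarith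
    subst h1a
    linear_combination -hd + j * hr
  have e2 : p * i' + r * j' + q * k' + 1 = q := by
    zify
    obtain rfl : d₁ = -(m * j' + k') + 1 := by linarith
    subst h2b
    linear_combination -hd + j' * hr
  have hi : i = 0 := by
    by_contra hi
    have := Nat.le_mul_of_pos_right p (Nat.pos_of_ne_zero hi)
    omega
  have hk0 : k' = 0 := by
    by_contra hk
    have := Nat.le_mul_of_pos_right q (Nat.pos_of_ne_zero hk)
    omega
  subst hi hk0
  have hj : m * j' = m * j + k + 1 := by
    zify
    push_cast at h2a
    linarith
  have hjj : j' = j + 1 := by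
    have l1 : j < j' := lt_of_mul_lt_mul_left (a := m) (by omega) (Nat.zero_le _)
    have l2 : j' < j + 2 := lt_of_mul_lt_mul_left (a := m) (by rw [mul_add]; omega) (Nat.zero_le _)
    omega
  subst hjj
  have hk1 : k + 1 = m := by rw [mul_add] at hj; omega
  have hi1 : i' + 1 = n := by
    zify
    push_cast at h1b h2b
    linarith
  have l1 := Nat.le_mul_of_pos_right q (show 0 < k by omega)
  have l2 := Nat.le_mul_of_pos_right p (show 0 < i' by omega)
  omega

/-- A locally nilpotent derivation of `B` kills `x` and maps `z` to a polynomial in `x`. -/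
theorem derivation_fx_fz [CharZero K] (hf' : 1 < f.natDegree) (hφ' : 1 < φ.natDegree)
    (D : Derivation K (DanSurfF K f φ) (DanSurfF K f φ))
    (hnil : ∀ b : DanSurfF K f φ, ∃ m : ℕ, D^[m] b = 0) :
    D (fx K f φ) = 0 ∧ ∃ h : K[X], D (fz K f φ) = aeval (fx K f φ) h := by
  have hf : f ≠ 0 := ne_zero_of_natDegree_gt hf'
  have hφ : 0 < φ.natDegree := by omega
  have hφ0 : φ ≠ 0 := ne_zero_of_natDegree_gt hφ
  by_cases hXZ : D (fx K f φ) = 0 ∧ D (fz K f φ) = 0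
  · exact ⟨hXZ.1, 0, by simpa using hXZ.2⟩
  have hX : serX K ≠ 0 := single_ne_zero one_ne_zero
  have hZ : serZ K ≠ 0 := single_ne_zero one_ne_zero
  have hD := toSeries_derivation hf D
  set P := -(toSeries φ hf (D (fz K f φ)) / serZ K) with hP
  set Q := -(toSeries φ hf (D (fx K f φ)) / serX K) with hQ
  have hPz : toSeries φ hf (D (fz K f φ)) = (-1 : K) • (P * serZ K) := by
    rw [hP]
    simp [hZ]
  have hQx : toSeries φ hf (D (fx K f φ)) = (-1 : K) • (Q * serX K) := by
    rw [hQ]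
    simp [hX]
  have hPQ : P ≠ 0 ∨ Q ≠ 0 := by
    by_contra! h
    refine hXZ ⟨toSeries_injective hf hφ ?_, toSeries_injective hf hφ ?_⟩
    · rw [hQx, h.2]; simp
    · rw [hPz, h.1]; simp
  obtain ⟨δ, α, β, hα, hβ, hαβ⟩ := HasLead.exists_common hPQ
  have hxl : (toSeries φ hf (fx K f φ)).HasLead (toLex (0, -1)) 1 := by
    rw [toSeries_fx]; exact HasLead.of_single _ _
  have hzl : (toSeries φ hf (fz K f φ)).HasLead (toLex (-1, 0)) 1 := by
    rw [toSeries_fz]; exact HasLead.of_single _ _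
  have hyl := hasLead_toSeries_fy hf hφ0
  obtain ⟨Nx, hNx⟩ := hnil (fx K f φ)
  obtain ⟨Ny, hNy⟩ := hnil (fy K f φ)
  obtain ⟨Nz, hNz⟩ := hnil (fz K f φ)
  obtain ⟨p, hp, hpm⟩ := exists_expForm_add_eq_zero hf hφ hD hα hβ hxl one_ne_zero hNx
  obtain ⟨q, hq, hqm⟩ := exists_expForm_add_eq_zero hf hφ hD hα hβ hzl one_ne_zero hNz
  obtain ⟨r, hr, -⟩ := exists_expForm_add_eq_zero hf hφ hD hα hβ hyl (by simp [hφ0, hf]) hNy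
  obtain ⟨⟨d₁, d₂⟩, rfl⟩ : ∃ e : ℤ × ℤ, δ = toLex e := ⟨ofLex δ, rfl⟩
  set ε := expForm α β (toLex (d₁, d₂)) with hε
  have hε' : ε = α * d₁ + β * d₂ := expForm_apply _ _ _
  simp only [expForm_apply, ofLex_toLex, Int.cast_neg, Int.cast_one, Int.cast_zero,
    Int.cast_natCast] at hp hq hr
  have hε0 : ε ≠ 0 := by
    intro h
    rw [h] at hp hq
    exact hαβ.elim (fun h' => h' (by linear_combination -hq))
      fun h' => h' (by linear_combination -hp)
  have hd : (p : ℤ) * d₂ + q * d₁ = 1 := by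
    have : ((p : K) * d₂ + q * d₁ - 1) * ε = 0 := by
      linear_combination d₂ * hp + d₁ * hq - hε'
    have := (mul_eq_zero.1 this).resolve_right hε0
    exact_mod_cast sub_eq_zero.1 this
  have hr' : (f.natDegree : ℤ) * p + r = φ.natDegree * q := by
    have : ((f.natDegree : K) * p + r - φ.natDegree * q) * ε = 0 := by
      linear_combination hr + f.natDegree * hp - φ.natDegree * hq
    have := (mul_eq_zero.1 this).resolve_right hε0
    exact_mod_cast sub_eq_zero.1 this
  have ex : (toLex (0, -1) + toLex (d₁, d₂) : ℤ ×ₗ ℤ) = toLex (d₁, d₂ - 1) := by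
    rw [← ofLex_inj]; ext <;> simp; ring
  have ez : (toLex (-1, 0) + toLex (d₁, d₂) : ℤ ×ₗ ℤ) = toLex (d₁ - 1, d₂) := by
    rw [← ofLex_inj]; ext <;> simp; ring
  have hp0 := shift_eq_one hf' hφ' hd hr' (ex ▸ hpm) (ez ▸ hqm)
  have hd1 : d₁ = 1 := by
    rw [hp0, Nat.cast_zero, zero_mul, zero_add] at hd
    rwa [Int.eq_one_of_mul_eq_one_right (Int.natCast_nonneg q) hd, one_mul] at hd
  constructor
  · refine eq_zero_of_hasLead hf hφ
      (hQx ▸ (hβ.mul (HasLead.of_single (toLex (0, -1)) 1)).const_smul (-1)) ?_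
    simp [hd1]
  · refine exists_eq_aeval_of_hasLead hf hφ
      (hPz ▸ (hα.mul (HasLead.of_single (toLex (-1, 0)) 1)).const_smul (-1)) ?_
    simp [hd1]

/-- If `f(x) * w = φ'(z) * h(x)` in `B`, then `f` divides `h`. -/
theorem exists_eq_mul_of_mul_eq [CharZero K] (hf : 0 < f.natDegree) (hφ : 1 < φ.natDegree)
    {w : DanSurfF K f φ} {h : K[X]}
    (hw : aeval (fx K f φ) f * w = aeval (fz K f φ) (derivative φ) * aeval (fx K f φ) h) :
    ∃ g : K[X], h = f * g ∧
      w = aeval (fx K f φ) g * aeval (fz K f φ) (derivative φ) := by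
  have hf0 : f ≠ 0 := ne_zero_of_natDegree_gt hf
  have hφ0 : 0 < φ.natDegree := by omega
  have hinj := toSeries_injective hf0 hφ0
  set w' := w - aeval (fx K f φ) (h / f) * aeval (fz K f φ) (derivative φ) with hw'
  have e : aeval (fx K f φ) f * w' =
      aeval (fz K f φ) (derivative φ) * aeval (fx K f φ) (h % f) := by
    have := congrArg (aeval (fx K f φ)) (EuclideanDomain.div_add_mod h f)
    rw [map_add, map_mul] at this
    rw [hw', mul_sub, hw, ← this]
    ring
  have e' := congrArg (toSeries φ hf0) e
  simp only [map_mul, ← aeval_algHom_apply, toSeries_fx, toSeries_fz] at e'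
  have hmod : h % f = 0 := by
    by_contra hne
    have hder : derivative φ ≠ 0 := fun h0 => by
      have := derivative_eq_zero.1 h0
      omega
    have hlead := (hasLead_aeval_serX f).of_mul (leadingCoeff_ne_zero.2 hf0)
      (e' ▸ (hasLead_aeval_serZ (derivative φ)).mul (hasLead_aeval_serX (h % f)))
      (mul_ne_zero (leadingCoeff_ne_zero.2 hder) (leadingCoeff_ne_zero.2 hne))
    obtain ⟨⟨i, j, k⟩, hu⟩ := mem_range_monExp hf0 hφ0 hlead (div_ne_zero
      (mul_ne_zero (leadingCoeff_ne_zero.2 hder) (leadingCoeff_ne_zero.2 hne))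
      (leadingCoeff_ne_zero.2 hf0))
    have h1 : -((φ.natDegree : ℤ) * j + (k : ℕ)) = -(derivative φ).natDegree + 0 - 0 :=
      congrArg (fun e => (ofLex e).1) hu
    have h2 : (f.natDegree : ℤ) * j - i = 0 + -((h % f).natDegree : ℤ) - -f.natDegree :=
      congrArg (fun e => (ofLex e).2) hu
    have hdlt : (derivative φ).natDegree < φ.natDegree := natDegree_derivative_lt hφ0.ne'
    have hmlt : (h % f).natDegree < f.natDegree := natDegree_mod_lt h hf.ne'
    have hj : j = 0 := by
      by_contra hj
      have := Nat.le_mul_of_pos_right φ.natDegree (Nat.pos_of_ne_zero hj)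
      have h1' : φ.natDegree * j + (k : ℕ) = (derivative φ).natDegree := by
        zify; linarith
      omega
    subst hj
    push_cast at h2
    omega
  rw [hmod, map_zero, mul_zero] at e'
  have hw0 : w' = 0 := hinj <| by
    rw [map_zero]
    exact (mul_eq_zero.1 e').resolve_left (aeval_serX_ne_zero hf0)
  refine ⟨h / f, ?_, sub_eq_zero.1 hw0⟩
  simpa [hmod] using (EuclideanDomain.div_add_mod h f).symm

end DanSurfF

namespace Derivation

variable {R A : Type*} [CommRing R] [CommRing A] [Algebra R A] (D : Derivation R A A)

theorem iterate_mul_eq_zero {m k : ℕ} {a b : A} (ha : D^[m] a = 0) (hb : D^[k] b = 0) :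
    D^[m + k] (a * b) = 0 := by
  induction hn : m + k generalizing m k a b with
  | zero =>
    obtain rfl : m = 0 := by omega
    have : a = 0 := ha
    simp [this]
  | succ n ih =>
    rcases m with _ | m
    · have : a = 0 := ha
      rw [this, zero_mul, iterate_map_zero]
    rcases k with _ | k
    · have : b = 0 := hb
      rw [this, mul_zero, iterate_map_zero]
    rw [Function.iterate_succ_apply, D.leibniz, smul_eq_mul, smul_eq_mul, iterate_map_add]
    rw [Function.iterate_succ_apply] at ha hb
    rw [ih (m := m + 1) (k := k) ha hb (by omega), ih (m := k + 1) (k := m) hb ha (by omega),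
      add_zero]

/-- The subalgebra of elements at which a derivation is nilpotent. -/
def nilSubalgebra : Subalgebra R A where
  carrier := {a | ∃ m : ℕ, D^[m] a = 0}
  mul_mem' := fun ⟨_, ha⟩ ⟨_, hb⟩ => ⟨_, D.iterate_mul_eq_zero ha hb⟩
  add_mem' := by
    rintro a b ⟨m, ha⟩ ⟨k, hb⟩
    refine ⟨m + k, ?_⟩
    rw [iterate_map_add, add_comm m k, Function.iterate_add_apply, ha, add_comm k m,
      Function.iterate_add_apply, hb, iterate_map_zero, iterate_map_zero, add_zero]
  algebraMap_mem' a := ⟨1, D.map_algebraMap a⟩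

theorem mem_nilSubalgebra_of_apply {a : A} (h : D a ∈ D.nilSubalgebra) : a ∈ D.nilSubalgebra := by
  obtain ⟨m, hm⟩ := h
  exact ⟨m + 1, hm⟩

end Derivation

/-- A `K`-derivation `D` of `B = K[X,Y,Z]/(f(X)Y - φ(Z))` is locally
nilpotent if and only if there exists `g ∈ K[X]` such that `D(x) = 0`,
`D(y) = g(x)·φ'(z)` and `D(z) = g(x)·f(x)`. -/
theorem locally_nilpotent_iff {K : Type*} [Field K] [IsAlgClosed K] [CharZero K]
    (f : Polynomial K) (hf : 1 < f.natDegree) (φ : Polynomial K) (hφ : 1 < φ.natDegree)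
    (D : Derivation K (DanSurfF K f φ) (DanSurfF K f φ)) :
    (∀ b : DanSurfF K f φ, ∃ m : ℕ, (⇑D)^[m] b = 0) ↔
      ∃ g : Polynomial K,
        D (fx K f φ) = 0 ∧
        D (fy K f φ) =
          Polynomial.aeval (fx K f φ) g *
            Polynomial.aeval (fz K f φ) (Polynomial.derivative φ) ∧
        D (fz K f φ) = Polynomial.aeval (fx K f φ) g * Polynomial.aeval (fx K f φ) f := by
  have hf0 : f ≠ 0 := Polynomial.ne_zero_of_natDegree_gt hf
  constructor
  · intro hnil
    obtain ⟨hx, h, hz⟩ := DanSurfF.derivation_fx_fz hf hφ D hnil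
    have hrel := congrArg D (DanSurfF.relation f φ)
    simp only [D.leibniz, Derivation.map_aeval, hx, hz, smul_eq_mul, mul_zero, add_zero] at hrel
    obtain ⟨g, rfl, hy⟩ := DanSurfF.exists_eq_mul_of_mul_eq (Nat.zero_lt_of_lt hf) hφ hrel
    exact ⟨g, hx, hy, by rw [hz, map_mul, mul_comm]⟩
  · rintro ⟨g, hx, hy, hz⟩ b
    have mem_aeval : ∀ (p : Polynomial K) {w}, w ∈ D.nilSubalgebra →
        Polynomial.aeval w p ∈ D.nilSubalgebra := fun p w hw =>
      Subalgebra.aeval_coe D.nilSubalgebra ⟨w, hw⟩ p ▸ Subtype.prop _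
    have hxm : fx K f φ ∈ D.nilSubalgebra := ⟨1, hx⟩
    have hzm : fz K f φ ∈ D.nilSubalgebra := D.mem_nilSubalgebra_of_apply <|
      hz ▸ mul_mem (mem_aeval g hxm) (mem_aeval f hxm)
    have hym : fy K f φ ∈ D.nilSubalgebra := D.mem_nilSubalgebra_of_apply <|
      hy ▸ mul_mem (mem_aeval g hxm) (mem_aeval _ hzm)
    change b ∈ D.nilSubalgebra
    induction b using DanSurfF.induction_on with
    | const a => exact Subalgebra.algebraMap_mem _ a
    | hx => exact hxm
    | hy => exact hym
    | hz => exact hzm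
    | add a b ha hb => exact add_mem ha hb
    | mul a b ha hb => exact mul_mem ha hb
end
end

section
/- Let D be the K-derivation of B with D(x) = 0, D(y) = g(x)·φ'(z), D(z) = g(x)·f(x), where g(X) ∈ K[X]. Then every triangular automorphism T of B commutes with D, i.e., T∘D = D∘T. -/
noncomputable section

namespace MvPolynomial

variable {σ K : Type*} [Field K]

theorem degreeOf_aeval_X_of_ne {i j : σ} (hij : j ≠ i) (p : Polynomial K) :
    (Polynomial.aeval (X i : MvPolynomial σ K) p).degreeOf j = 0 := by
  have hmem : Polynomial.aeval (X i : MvPolynomial σ K) p ∈ supported K {i} := by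
    rw [supported_eq_adjoin_X, Set.image_singleton]
    exact Polynomial.aeval_mem_adjoin_singleton K _
  by_contra hdeg
  exact hij (mem_supported.mp hmem (mem_vars_iff_degreeOf_ne_zero.mpr hdeg))

theorem aeval_X_ne_zero (i : σ) {p : Polynomial K} (hp : p ≠ 0) :
    Polynomial.aeval (X i : MvPolynomial σ K) p ≠ 0 :=
  fun h0 => hp (transcendental_iff.mp (transcendental_X K i) p h0)

theorem degreeOf_eq_zero_of_dvd {p q : MvPolynomial σ K} {i : σ} (hpq : p ∣ q) (hq : q ≠ 0)
    (hdeg : q.degreeOf i = 0) : p.degreeOf i = 0 := by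
  obtain ⟨r, rfl⟩ := hpq
  rw [degreeOf_mul_eq (left_ne_zero_of_mul hq) (right_ne_zero_of_mul hq)] at hdeg
  omega

/-- Nonzero univariate polynomials in two different variables are relatively prime. -/
theorem isRelPrime_aeval_X {i j : σ} (hij : i ≠ j) {p q : Polynomial K} (hp : p ≠ 0)
    (hq : q ≠ 0) :
    IsRelPrime (Polynomial.aeval (X i : MvPolynomial σ K) p) (Polynomial.aeval (X j) q) := by
  intro d hdp hdq
  have hvars : d.vars = ∅ := by
    refine Finset.eq_empty_of_forall_notMem fun k hk => mem_vars_iff_degreeOf_ne_zero.mp hk ?_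
    by_cases hki : k = i
    · exact degreeOf_eq_zero_of_dvd hdq (aeval_X_ne_zero j hq)
        (degreeOf_aeval_X_of_ne (hki ▸ hij) q)
    · exact degreeOf_eq_zero_of_dvd hdp (aeval_X_ne_zero i hp) (degreeOf_aeval_X_of_ne hki p)
  have hd := vars_eq_empty_iff_eq_C.mp hvars
  have hd0 : d ≠ 0 := ne_zero_of_dvd_ne_zero (aeval_X_ne_zero i hp) hdp
  rw [hd] at hd0 ⊢
  exact (isUnit_iff_ne_zero.mpr fun h0 => hd0 (by rw [h0, C_0])).map C

end MvPolynomial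

namespace DanSurfF

variable {K : Type*} [Field K] {f φ : Polynomial K}

/-- The quotient map `K[X,Y,Z] → B`. -/
def mkₐ (f φ : Polynomial K) : MvPolynomial (Fin 3) K →ₐ[K] DanSurfF K f φ :=
  Ideal.Quotient.mkₐ K (danIdealF K f φ)

theorem mkₐ_surjective : Function.Surjective (mkₐ f φ) :=
  Ideal.Quotient.mk_surjective

theorem mkₐ_eq_zero_iff {p : MvPolynomial (Fin 3) K} :
    mkₐ f φ p = 0 ↔ Polynomial.aeval (MvPolynomial.X 0) f * MvPolynomial.X 1 -
      Polynomial.aeval (MvPolynomial.X 2) φ ∣ p :=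
  Ideal.Quotient.eq_zero_iff_mem.trans Ideal.mem_span_singleton

theorem mkₐ_X_zero : mkₐ f φ (MvPolynomial.X 0) = fx K f φ := rfl

theorem mkₐ_X_one : mkₐ f φ (MvPolynomial.X 1) = fy K f φ := rfl

theorem mkₐ_X_two : mkₐ f φ (MvPolynomial.X 2) = fz K f φ := rfl

theorem eq_zero_of_aeval_fx_mul_eq_zero (hf : f ≠ 0) (hφ : φ ≠ 0) {b : DanSurfF K f φ}
    (hb : Polynomial.aeval (fx K f φ) f * b = 0) : b = 0 := by
  obtain ⟨p, rfl⟩ := mkₐ_surjective b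
  rw [← mkₐ_X_zero, Polynomial.aeval_algHom_apply, ← map_mul, mkₐ_eq_zero_iff] at hb
  obtain ⟨q, hq⟩ := hb
  have hdvd : Polynomial.aeval (MvPolynomial.X 0 : MvPolynomial (Fin 3) K) f ∣
      q * Polynomial.aeval (MvPolynomial.X 2) φ :=
    ⟨MvPolynomial.X 1 * q - p, by linear_combination hq⟩
  obtain ⟨r, rfl⟩ :=
    (MvPolynomial.isRelPrime_aeval_X (by decide) hf hφ).dvd_of_dvd_mul_right hdvd
  refine mkₐ_eq_zero_iff.mpr ⟨r, mul_left_cancel₀ (MvPolynomial.aeval_X_ne_zero 0 hf) ?_⟩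
  linear_combination hq

/-- An algebra endomorphism commutes with a derivation of `B` as soon as it does on `x, y, z`. -/
theorem map_derivation_apply (T : DanSurfF K f φ →ₐ[K] DanSurfF K f φ)
    (D : Derivation K (DanSurfF K f φ) (DanSurfF K f φ))
    (hx : T (D (fx K f φ)) = D (T (fx K f φ))) (hy : T (D (fy K f φ)) = D (T (fy K f φ)))
    (hz : T (D (fz K f φ)) = D (T (fz K f φ))) (b : DanSurfF K f φ) :
    T (D b) = D (T b) := by
  obtain ⟨p, rfl⟩ := mkₐ_surjective b
  induction p using MvPolynomial.induction_on with
  | C a => simp [← MvPolynomial.algebraMap_eq, AlgHom.commutes]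
  | add p q hp hq => simp only [map_add, hp, hq]
  | mul_X p i hp =>
    have hi : T (D (mkₐ f φ (MvPolynomial.X i))) = D (T (mkₐ f φ (MvPolynomial.X i))) := by
      fin_cases i
      exacts [hx, hy, hz]
    simp only [map_mul, Derivation.leibniz, smul_eq_mul, map_add, hp, hi]

end DanSurfF

/-- Every triangular automorphism `T` of
`B = K[X,Y,Z]/(f(X)Y - φ(Z))` (`T(x) = x`, `T(z) = z + h(x)·f(x)`,
`f(x)·T(y) = φ(T(z))` for some `h ∈ K[X]`) commutes with the locally nilpotent
derivation `D` given by `D(x) = 0`, `D(y) = g(x)·φ'(z)`, `D(z) = g(x)·f(x)`. -/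
theorem triangular_commutes_fx {K : Type*} [Field K] [IsAlgClosed K] [CharZero K]
    (f : Polynomial K) (hf : 1 < f.natDegree) (φ : Polynomial K) (hφ : 1 < φ.natDegree)
    (g : Polynomial K)
    (D : Derivation K (DanSurfF K f φ) (DanSurfF K f φ))
    (hDx : D (fx K f φ) = 0)
    (hDy : D (fy K f φ) =
      Polynomial.aeval (fx K f φ) g *
        Polynomial.aeval (fz K f φ) (Polynomial.derivative φ))
    (hDz : D (fz K f φ) =
      Polynomial.aeval (fx K f φ) g * Polynomial.aeval (fx K f φ) f)
    (T : DanSurfF K f φ ≃ₐ[K] DanSurfF K f φ) (h : Polynomial K)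
    (hTx : T (fx K f φ) = fx K f φ)
    (hTz : T (fz K f φ) =
      fz K f φ + Polynomial.aeval (fx K f φ) h * Polynomial.aeval (fx K f φ) f)
    (hTy : Polynomial.aeval (fx K f φ) f * T (fy K f φ) =
      Polynomial.aeval (T (fz K f φ)) φ) :
    ∀ b, T (D b) = D (T b) := by
  have hDpx (p : Polynomial K) : D (Polynomial.aeval (fx K f φ) p) = 0 := by
    rw [Derivation.map_aeval, hDx, smul_zero]
  have hTpx (p : Polynomial K) :
      T (Polynomial.aeval (fx K f φ) p) = Polynomial.aeval (fx K f φ) p := by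
    rw [← Polynomial.aeval_algHom_apply, hTx]
  have hDTz : D (T (fz K f φ)) =
      Polynomial.aeval (fx K f φ) g * Polynomial.aeval (fx K f φ) f := by
    rw [hTz, map_add, Derivation.leibniz, hDpx, hDpx, hDz, smul_zero, smul_zero, add_zero,
      add_zero]
  have hf0 : f ≠ 0 := Polynomial.ne_zero_of_natDegree_gt hf
  have hφ0 : φ ≠ 0 := Polynomial.ne_zero_of_natDegree_gt hφ
  refine DanSurfF.map_derivation_apply T.toAlgHom D ?_ ?_ ?_
  · change T (D (fx K f φ)) = D (T (fx K f φ))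
    rw [hTx, hDx, map_zero]
  · change T (D (fy K f φ)) = D (T (fy K f φ))
    refine sub_eq_zero.mp (DanSurfF.eq_zero_of_aeval_fx_mul_eq_zero hf0 hφ0 ?_)
    have hTφ : T (Polynomial.aeval (fz K f φ) (Polynomial.derivative φ)) =
        Polynomial.aeval (T (fz K f φ)) (Polynomial.derivative φ) :=
      (Polynomial.aeval_algHom_apply T _ _).symm
    have hDTy := congrArg D hTy
    rw [Derivation.leibniz, hDpx, smul_zero, add_zero, Derivation.map_aeval, hDTz, smul_eq_mul,
      smul_eq_mul] at hDTy
    rw [mul_sub, hDTy, hDy, map_mul, hTpx, hTφ]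
    ring
  · change T (D (fz K f φ)) = D (T (fz K f φ))
    rw [hDTz, hDz, map_mul, hTpx, hTpx]
end
end

section
/- Let D be the K-derivation of B with D(x) = 0, D(y) = g(x)·φ'(z), D(z) = g(x)·f(x), where g(X) ∈ K[X] is nonzero. Let ρ be a K-algebra automorphism of B with ρ(x) = x and ρ(z) = μz for some μ ∈ K*. If ρ commutes with D, then μ = 1. -/
noncomputable section

/-- The polynomial `p(x)` vanishes in `B` only if `p = 0`: a root `c` of `φ` gives the retraction
`B → K[X]` sending `x, y, z` to `X, 0, c`. -/
theorem aeval_fx_injective {K : Type*} [Field K] [IsAlgClosed K] (f φ : Polynomial K)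
    (hφ : φ.degree ≠ 0) :
    Function.Injective (Polynomial.aeval (R := K) (fx K f φ)) := by
  obtain ⟨c, hc⟩ := IsAlgClosed.exists_root φ hφ
  let ψ : MvPolynomial (Fin 3) K →ₐ[K] Polynomial K :=
    MvPolynomial.aeval ![Polynomial.X, 0, Polynomial.C c]
  have hψ : ∀ a ∈ danIdealF K f φ, ψ a = 0 := by
    suffices h : danIdealF K f φ ≤ RingHom.ker ψ from fun a ha => h ha
    rw [danIdealF, Ideal.span_singleton_le_iff_mem, RingHom.mem_ker, map_sub, map_mul,
      ← Polynomial.aeval_algHom_apply, ← Polynomial.aeval_algHom_apply]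
    have hc' : Polynomial.aeval (Polynomial.C c) φ = 0 := by
      rw [← Polynomial.algebraMap_eq, Polynomial.aeval_algebraMap_apply, Polynomial.coe_aeval_eq_eval,
        hc.eq_zero, map_zero]
    simp [ψ, hc']
  let π : DanSurfF K f φ →ₐ[K] Polynomial K := Ideal.Quotient.liftₐ (danIdealF K f φ) ψ hψ
  have hπ : π (fx K f φ) = Polynomial.X := by
    change ψ (MvPolynomial.X 0) = Polynomial.X
    simp [ψ]
  refine Function.LeftInverse.injective (g := π) fun p => ?_
  rw [← Polynomial.aeval_algHom_apply, hπ, Polynomial.aeval_X_left_apply]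

/-- Let `D` be the `K`-derivation of `B = K[X,Y,Z]/(f(X)Y - φ(Z))`
with `D(x) = 0`, `D(y) = g(x)·φ'(z)`, `D(z) = g(x)·f(x)` (`g ≠ 0`), and let `ρ` be a
`K`-algebra automorphism of `B` with `ρ(x) = x` and `ρ(z) = μz` for some `μ ∈ K*`.
If `ρ` commutes with `D`, then `μ = 1`. -/
theorem rescaling_in_isotropy_is_trivial_fx {K : Type*} [Field K] [IsAlgClosed K] [CharZero K]
    (f : Polynomial K) (hf : 1 < f.natDegree) (φ : Polynomial K) (hφ : 1 < φ.natDegree)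
    (g : Polynomial K) (hg : g ≠ 0)
    (D : Derivation K (DanSurfF K f φ) (DanSurfF K f φ))
    (hDx : D (fx K f φ) = 0)
    (hDy : D (fy K f φ) =
      Polynomial.aeval (fx K f φ) g *
        Polynomial.aeval (fz K f φ) (Polynomial.derivative φ))
    (hDz : D (fz K f φ) =
      Polynomial.aeval (fx K f φ) g * Polynomial.aeval (fx K f φ) f)
    (ρ : DanSurfF K f φ ≃ₐ[K] DanSurfF K f φ) (μ : K) (hμ : μ ≠ 0)
    (hρx : ρ (fx K f φ) = fx K f φ)
    (hρz : ρ (fz K f φ) = μ • fz K f φ)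
    (hcomm : ∀ b, ρ (D b) = D (ρ b)) :
    μ = 1 := by
  have hf0 : f ≠ 0 := Polynomial.ne_zero_of_natDegree_gt hf
  have hinj := aeval_fx_injective f φ
    (Polynomial.natDegree_pos_iff_degree_pos.mp (zero_lt_one.trans hφ)).ne'
  have h : Polynomial.aeval (fx K f φ) (g * f) = Polynomial.aeval (fx K f φ) (μ • (g * f)) := by
    have hz := hcomm (fz K f φ)
    rw [hρz, D.map_smul, hDz, ← map_mul, ← Polynomial.aeval_algHom_apply] at hz
    simpa [hρx] using hz
  have hμ' := hinj h
  rw [eq_comm, ← sub_eq_zero, ← one_smul K (g * f), smul_smul, mul_one, ← sub_smul] at hμ'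
  exact sub_eq_zero.mp ((smul_eq_zero.mp hμ').resolve_right (mul_ne_zero hg hf0))
end
end
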